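/- arXiv:1811.07795 — 9 statements merged into one kernel-verified Lean document; each statement's English description precedes it below -/
import Mathlib

section
/- Let d ≥ 1 and let A be a real invertible (2d)×(2d) matrix with d×d blocks A₁₁, A₁₂, A₂₁, A₂₂. Suppose the matrix-Wigner distribution B_A satisfies the Cohen-class covariance property: for every Schwartz function f : ℝ^d → ℂ and all x, ω, y, η ∈ ℝ^d one has B_A(M_ω T_x f, M_ω T_x f)(y, η) = B_A(f, f)(y − x, η − ω). Then there exists a real d×d matrix M such that A₁₁ = A₂₁ = I, A₁₂ = M + (1/2)I and A₂₂ = M − (1/2)I, i.e. A is a Cohen-type matrix A_M. -/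
open MeasureTheory Matrix ComplexConjugate
open scoped Real Matrix

/-- The matrix-Wigner distribution `B_A(f,g)` associated with the `2d × 2d` matrix with
`d × d` blocks `A₁₁, A₁₂, A₂₁, A₂₂`. -/
noncomputable def mwd {d : ℕ} (A₁₁ A₁₂ A₂₁ A₂₂ : Matrix (Fin d) (Fin d) ℝ)
    (f g : (Fin d → ℝ) → ℂ) (x ω : Fin d → ℝ) : ℂ :=
  ∫ y : Fin d → ℝ,
    Complex.exp (-2 * (Real.pi : ℂ) * Complex.I * ((ω ⬝ᵥ y : ℝ) : ℂ)) *
      f (A₁₁.mulVec x + A₁₂.mulVec y) * conj (g (A₂₁.mulVec x + A₂₂.mulVec y))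

/-- Pairing two functions of compact support along the affine slice `s ↦ A (y, s)` of an
invertible block matrix gives a function of compact support. -/
theorem hasCompactSupport_mul_comp_fromBlocks {d : ℕ} {A₁₁ A₁₂ A₂₁ A₂₂ : Matrix (Fin d) (Fin d) ℝ}
    (hA : (Matrix.fromBlocks A₁₁ A₁₂ A₂₁ A₂₂).det ≠ 0) {φ ψ : (Fin d → ℝ) → ℝ}
    (hφ : HasCompactSupport φ) (hψ : HasCompactSupport ψ) (y : Fin d → ℝ) :
    HasCompactSupport fun s : Fin d → ℝ =>
      φ (A₁₁.mulVec y + A₁₂.mulVec s) * ψ (A₂₁.mulVec y + A₂₂.mulVec s) := by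
  let F : (Fin d → ℝ) × (Fin d → ℝ) → Fin d → ℝ := fun p i =>
    ((Matrix.fromBlocks A₁₁ A₁₂ A₂₁ A₂₂)⁻¹.mulVec (Sum.elim p.1 p.2)) (Sum.inr i)
  have hF : Continuous F := by
    refine continuous_pi fun i => ?_
    have h : Continuous fun p : (Fin d → ℝ) × (Fin d → ℝ) => Sum.elim p.1 p.2 := by
      refine continuous_pi fun j => ?_
      cases j <;> simp only [Sum.elim_inl, Sum.elim_inr] <;> fun_prop
    exact (continuous_apply (Sum.inr i)).comp (continuous_const.matrix_mulVec h)
  refine HasCompactSupport.intro ((hφ.isCompact.prod hψ.isCompact).image hF) fun s hs => ?_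
  by_contra hne
  refine hs ⟨(A₁₁.mulVec y + A₁₂.mulVec s, A₂₁.mulVec y + A₂₂.mulVec s),
    ⟨subset_tsupport _ (left_ne_zero_of_mul hne), subset_tsupport _ (right_ne_zero_of_mul hne)⟩, ?_⟩
  have h : Sum.elim (A₁₁.mulVec y + A₁₂.mulVec s) (A₂₁.mulVec y + A₂₂.mulVec s)
      = (Matrix.fromBlocks A₁₁ A₁₂ A₂₁ A₂₂).mulVec (Sum.elim y s) := by
    rw [Matrix.fromBlocks_mulVec]; simp
  funext i
  simp only [F, h, Matrix.mulVec_mulVec, Matrix.nonsing_inv_mul _ (Ne.isUnit hA),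
    Matrix.one_mulVec, Sum.elim_inr]

/-- A nonnegative continuous integrable function with vanishing integral is zero. -/
theorem eq_zero_of_integral_eq_zero_of_nonneg {d : ℕ} {g : (Fin d → ℝ) → ℝ} (hg : Continuous g)
    (hnn : ∀ s, 0 ≤ g s) (hint : Integrable g) (h : ∫ s, g s = 0) (s : Fin d → ℝ) : g s = 0 := by
  have hae := (integral_eq_zero_iff_of_nonneg hnn hint).1 h
  exact congrFun ((Continuous.ae_eq_iff_eq volume hg continuous_zero).1 hae) s

/-- A real number all of whose multiples have cosine one vanishes. -/
theorem eq_zero_of_forall_cos_mul_eq_one {c : ℝ} (h : ∀ t : ℝ, Real.cos (t * c) = 1) : c = 0 := by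
  by_contra hc
  have := h (π / 2 / c)
  rw [div_mul_cancel₀ _ hc, Real.cos_pi_div_two] at this
  exact zero_ne_one this

/-- The Schwartz function with values in `[0, 1]` given by a smooth bump function. -/
noncomputable def ContDiffBump.toComplexSchwartz {d : ℕ} (φ : ContDiffBump (0 : Fin d → ℝ)) :
    SchwartzMap (Fin d → ℝ) ℂ :=
  HasCompactSupport.toSchwartzMap (f := fun t => ((φ t : ℝ) : ℂ))
    (φ.hasCompactSupport.comp_left (g := fun r : ℝ => (r : ℂ)) Complex.ofReal_zero)
    (Complex.ofRealCLM.contDiff.comp φ.contDiff)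

theorem ContDiffBump.toComplexSchwartz_apply {d : ℕ} (φ : ContDiffBump (0 : Fin d → ℝ))
    (t : Fin d → ℝ) : φ.toComplexSchwartz t = ((φ t : ℝ) : ℂ) := rfl

/-- On a time-frequency shift of a real function, the matrix-Wigner distribution on the diagonal
frequency `η = ω` is the integral of a real amplitude times an explicit phase. -/
theorem re_mwd_modulated {d : ℕ} (A₁₁ A₁₂ A₂₁ A₂₂ : Matrix (Fin d) (Fin d) ℝ)
    (φ : (Fin d → ℝ) → ℝ) (ω y : Fin d → ℝ)
    (hint : Integrable fun s => φ (A₁₁.mulVec y + A₁₂.mulVec s) * φ (A₂₁.mulVec y + A₂₂.mulVec s)) :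
    (mwd A₁₁ A₁₂ A₂₁ A₂₂
      (fun t => Complex.exp (2 * (Real.pi : ℂ) * Complex.I * ((t ⬝ᵥ ω : ℝ) : ℂ)) * (φ t : ℂ))
      (fun t => Complex.exp (2 * (Real.pi : ℂ) * Complex.I * ((t ⬝ᵥ ω : ℝ) : ℂ)) * (φ t : ℂ))
      y ω).re
    = ∫ s : Fin d → ℝ,
      Real.cos (2 * π * ((A₁₁.mulVec y + A₁₂.mulVec s - (A₂₁.mulVec y + A₂₂.mulVec s) - s) ⬝ᵥ ω)) *
        (φ (A₁₁.mulVec y + A₁₂.mulVec s) * φ (A₂₁.mulVec y + A₂₂.mulVec s)) := by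
  have key : ∀ s : Fin d → ℝ,
      Complex.exp (-2 * (Real.pi : ℂ) * Complex.I * ((ω ⬝ᵥ s : ℝ) : ℂ)) *
        (Complex.exp (2 * (Real.pi : ℂ) * Complex.I *
          (((A₁₁.mulVec y + A₁₂.mulVec s) ⬝ᵥ ω : ℝ) : ℂ)) * (φ (A₁₁.mulVec y + A₁₂.mulVec s) : ℂ)) *
        conj (Complex.exp (2 * (Real.pi : ℂ) * Complex.I *
          (((A₂₁.mulVec y + A₂₂.mulVec s) ⬝ᵥ ω : ℝ) : ℂ)) * (φ (A₂₁.mulVec y + A₂₂.mulVec s) : ℂ))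
      = Complex.exp (((2 * π * ((A₁₁.mulVec y + A₁₂.mulVec s -
          (A₂₁.mulVec y + A₂₂.mulVec s) - s) ⬝ᵥ ω) : ℝ) : ℂ) * Complex.I) *
        ((φ (A₁₁.mulVec y + A₁₂.mulVec s) * φ (A₂₁.mulVec y + A₂₂.mulVec s) : ℝ) : ℂ) := by
    intro s
    have h : Complex.exp (((2 * π * ((A₁₁.mulVec y + A₁₂.mulVec s -
          (A₂₁.mulVec y + A₂₂.mulVec s) - s) ⬝ᵥ ω) : ℝ) : ℂ) * Complex.I) =
        Complex.exp (-2 * (Real.pi : ℂ) * Complex.I * ((ω ⬝ᵥ s : ℝ) : ℂ)) *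
        Complex.exp (2 * (Real.pi : ℂ) * Complex.I *
          (((A₁₁.mulVec y + A₁₂.mulVec s) ⬝ᵥ ω : ℝ) : ℂ)) *
        Complex.exp (-(2 * (Real.pi : ℂ) * Complex.I *
          (((A₂₁.mulVec y + A₂₂.mulVec s) ⬝ᵥ ω : ℝ) : ℂ))) := by
      rw [← Complex.exp_add, ← Complex.exp_add, sub_dotProduct, sub_dotProduct,
        dotProduct_comm ω s]
      congr 1
      push_cast
      ring
    rw [h, map_mul, ← Complex.exp_conj]
    simp only [map_mul, Complex.conj_ofReal, Complex.conj_I, map_ofNat]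
    push_cast
    ring_nf
  have hint' : Integrable fun s : Fin d → ℝ =>
      Complex.exp (((2 * π * ((A₁₁.mulVec y + A₁₂.mulVec s -
          (A₂₁.mulVec y + A₂₂.mulVec s) - s) ⬝ᵥ ω) : ℝ) : ℂ) * Complex.I) *
        ((φ (A₁₁.mulVec y + A₁₂.mulVec s) * φ (A₂₁.mulVec y + A₂₂.mulVec s) : ℝ) : ℂ) := by
    refine hint.ofReal.bdd_mul (c := 1) ?_ (ae_of_all _ fun s => ?_)
    · refine Continuous.aestronglyMeasurable ?_
      fun_prop
    · exact (Complex.norm_exp_ofReal_mul_I _).le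
  unfold mwd
  simp only [key]
  have h := integral_re hint'
  simp only [RCLike.re_eq_complex_re] at h
  rw [← h]
  refine integral_congr_ae (ae_of_all _ fun s => ?_)
  simp only [Complex.re_mul_ofReal, Complex.exp_ofReal_mul_I_re]

/-- If the matrix-Wigner distribution `B_A` satisfies the Cohen-class covariance property,
then `A` is a Cohen-type matrix `A_M` for some real `d × d` matrix `M`. -/
theorem mwd_covariance_implies_cohen_type {d : ℕ} (hd : 1 ≤ d)
    (A₁₁ A₁₂ A₂₁ A₂₂ : Matrix (Fin d) (Fin d) ℝ)
    (hA : (Matrix.fromBlocks A₁₁ A₁₂ A₂₁ A₂₂).det ≠ 0)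
    (hcov : ∀ (f : SchwartzMap ((Fin d) → ℝ) ℂ) (x ω y η : Fin d → ℝ),
      mwd A₁₁ A₁₂ A₂₁ A₂₂
        (fun t => Complex.exp (2 * (Real.pi : ℂ) * Complex.I * ((t ⬝ᵥ ω : ℝ) : ℂ)) * f (t - x))
        (fun t => Complex.exp (2 * (Real.pi : ℂ) * Complex.I * ((t ⬝ᵥ ω : ℝ) : ℂ)) * f (t - x))
        y η
      = mwd A₁₁ A₁₂ A₂₁ A₂₂ (⇑f) (⇑f) (y - x) (η - ω)) :
    ∃ M : Matrix (Fin d) (Fin d) ℝ,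
      A₁₁ = 1 ∧ A₂₁ = 1 ∧
      A₁₂ = M + (2⁻¹ : ℝ) • 1 ∧ A₂₂ = M - (2⁻¹ : ℝ) • 1 := by
  have integrable : ∀ (φ : ContDiffBump (0 : Fin d → ℝ)) (y : Fin d → ℝ), Integrable
      fun s : Fin d → ℝ => φ (A₁₁.mulVec y + A₁₂.mulVec s) * φ (A₂₁.mulVec y + A₂₂.mulVec s) := by
    intro φ y
    refine Continuous.integrable_of_hasCompactSupport ?_
      (hasCompactSupport_mul_comp_fromBlocks hA φ.hasCompactSupport φ.hasCompactSupport y)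
    have := φ.continuous
    fun_prop
  have phase : ∀ y s : Fin d → ℝ,
      A₁₁.mulVec y + A₁₂.mulVec s - (A₂₁.mulVec y + A₂₂.mulVec s) - s = 0 := by
    intro y s
    set R : ℝ := ‖A₁₁.mulVec y + A₁₂.mulVec s‖ + ‖A₂₁.mulVec y + A₂₂.mulVec s‖ + 1 with hR
    have hn₁ := norm_nonneg (A₁₁.mulVec y + A₁₂.mulVec s)
    have hn₂ := norm_nonneg (A₂₁.mulVec y + A₂₂.mulVec s)
    let φ : ContDiffBump (0 : Fin d → ℝ) := ⟨R, R + 1, by linarith, by linarith⟩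
    have h₁ : φ (A₁₁.mulVec y + A₁₂.mulVec s) = 1 :=
      φ.one_of_mem_closedBall (by rw [mem_closedBall_zero_iff]; change _ ≤ R; linarith)
    have h₂ : φ (A₂₁.mulVec y + A₂₂.mulVec s) = 1 :=
      φ.one_of_mem_closedBall (by rw [mem_closedBall_zero_iff]; change _ ≤ R; linarith)
    have hcos : ∀ ω : Fin d → ℝ, Real.cos (2 * π *
        ((A₁₁.mulVec y + A₁₂.mulVec s - (A₂₁.mulVec y + A₂₂.mulVec s) - s) ⬝ᵥ ω)) = 1 := by
      intro ω
      have h := congrArg Complex.re (hcov φ.toComplexSchwartz 0 ω y ω)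
      have h0 := re_mwd_modulated A₁₁ A₁₂ A₂₁ A₂₂ φ 0 y (integrable φ y)
      simp only [φ.toComplexSchwartz_apply, sub_zero, sub_self] at h
      rw [re_mwd_modulated _ _ _ _ _ _ _ (integrable φ y)] at h
      simp only [dotProduct_zero, Complex.ofReal_zero, mul_zero, Complex.exp_zero, one_mul,
        Real.cos_zero] at h0
      have h0' : (mwd A₁₁ A₁₂ A₂₁ A₂₂ φ.toComplexSchwartz φ.toComplexSchwartz y 0).re = _ := h0
      rw [h0'] at h
      set g : (Fin d → ℝ) → ℝ := fun s =>
        φ (A₁₁.mulVec y + A₁₂.mulVec s) * φ (A₂₁.mulVec y + A₂₂.mulVec s) with hg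
      set c : (Fin d → ℝ) → ℝ := fun s => Real.cos (2 * π *
        ((A₁₁.mulVec y + A₁₂.mulVec s - (A₂₁.mulVec y + A₂₂.mulVec s) - s) ⬝ᵥ ω)) with hc
      have hcc : Continuous c := by fun_prop
      have hgc : Continuous g := by have := φ.continuous; fun_prop
      have hcg : Integrable fun s => c s * g s :=
        (integrable φ y).bdd_mul (c := 1) hcc.aestronglyMeasurable
          (ae_of_all _ fun s => Real.abs_cos_le_one _)
      have hz : ∫ s, (g s - c s * g s) = 0 := by
        rw [integral_sub (integrable φ y) hcg]
        exact sub_eq_zero.2 h.symm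
      have hnn : ∀ s, 0 ≤ g s - c s * g s := fun s => by
        have hg0 : 0 ≤ g s := mul_nonneg φ.nonneg φ.nonneg
        have hc1 : c s ≤ 1 := Real.cos_le_one _
        nlinarith
      have hs : g s - c s * g s = 0 := eq_zero_of_integral_eq_zero_of_nonneg
        (hgc.sub (hcc.mul hgc)) hnn ((integrable φ y).sub hcg) hz s
      have hgs : g s = 1 := by simp only [hg, h₁, h₂, mul_one]
      simp only [hgs, mul_one] at hs
      exact (sub_eq_zero.1 hs).symm
    refine dotProduct_eq_zero _ fun ω => eq_zero_of_forall_cos_mul_eq_one fun t => ?_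
    have h := hcos ((t / (2 * π)) • ω)
    rw [dotProduct_smul, smul_eq_mul, ← mul_assoc, mul_div_cancel₀ _ (by positivity)] at h
    exact h
  have hcol : A₁₁ = A₂₁ := by
    refine Matrix.ext_of_mulVec_single fun i => ?_
    have := phase (Pi.single i 1) 0
    simpa [sub_eq_zero] using this
  have hdiff : A₁₂ = A₂₂ + 1 := by
    refine Matrix.ext_of_mulVec_single fun i => ?_
    have := phase 0 (Pi.single i 1)
    simp only [mulVec_zero, zero_add] at this
    rw [Matrix.add_mulVec, Matrix.one_mulVec, ← sub_eq_zero, ← this]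
    abel
  have hone : A₁₁ = 1 := by
    refine Matrix.ext_of_mulVec_single fun i => ?_
    rw [Matrix.one_mulVec]
    by_contra hne
    set x : Fin d → ℝ := Pi.single i 1
    set w : Fin d → ℝ := A₁₁.mulVec x - x with hw
    have hw0 : 0 < ‖w‖ := norm_pos_iff.2 (sub_ne_zero.2 hne)
    let φ : ContDiffBump (0 : Fin d → ℝ) := ⟨1, 2, one_pos, one_lt_two⟩
    let L : (Fin d → ℝ) →L[ℝ] (Fin d → ℝ) := A₂₂.mulVecLin.toContinuousLinearMap
    have hL : ∀ s, L s = A₂₂.mulVec s := fun s => rfl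
    let t : ℝ := (2 + ‖L‖ * 4) / ‖w‖
    have ht : t * ‖w‖ = 2 + ‖L‖ * 4 := div_mul_cancel₀ _ hw0.ne'
    have hvanish : ∀ s, φ (t • w + A₁₂.mulVec s) * φ (t • w + A₂₂.mulVec s) = 0 := by
      intro s
      by_contra hprod
      have m₁ : t • w + A₁₂.mulVec s ∈ Function.support φ := left_ne_zero_of_mul hprod
      have m₂ : t • w + A₂₂.mulVec s ∈ Function.support φ := right_ne_zero_of_mul hprod
      rw [φ.support_eq, mem_ball_zero_iff] at m₁ m₂
      change _ < (2 : ℝ) at m₁ m₂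
      have hs : ‖s‖ ≤ 4 := by
        have e : s = (t • w + A₁₂.mulVec s) - (t • w + A₂₂.mulVec s) := by
          rw [hdiff, Matrix.add_mulVec, Matrix.one_mulVec]; abel
        rw [e]
        exact (norm_sub_le _ _).trans (by linarith)
      have hLs : ‖A₂₂.mulVec s‖ ≤ ‖L‖ * 4 :=
        (L.le_opNorm s).trans (mul_le_mul_of_nonneg_left hs (norm_nonneg _))
      have htw : t * ‖w‖ ≤ ‖t • w‖ := by
        rw [norm_smul]
        exact mul_le_mul_of_nonneg_right (le_abs_self t) hw0.le
      have htri : ‖t • w‖ ≤ ‖t • w + A₂₂.mulVec s‖ + ‖A₂₂.mulVec s‖ := by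
        simpa using norm_sub_le (t • w + A₂₂.mulVec s) (A₂₂.mulVec s)
      linarith
    have h := congrArg Complex.re (hcov φ.toComplexSchwartz (t • x) 0 (t • x) 0)
    have h0 := re_mwd_modulated A₁₁ A₁₂ A₂₁ A₂₂ φ 0 0 (integrable φ 0)
    simp only [dotProduct_zero, Complex.ofReal_zero, mul_zero, Complex.exp_zero, one_mul,
      Real.cos_zero] at h0
    simp only [dotProduct_zero, Complex.ofReal_zero, mul_zero, Complex.exp_zero, one_mul,
      sub_self] at h
    have h0' : (mwd A₁₁ A₁₂ A₂₁ A₂₂ φ.toComplexSchwartz φ.toComplexSchwartz 0 0).re = _ := h0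
    rw [h0'] at h
    have hleft : mwd A₁₁ A₁₂ A₂₁ A₂₂ (fun u => φ.toComplexSchwartz (u - t • x))
        (fun u => φ.toComplexSchwartz (u - t • x)) (t • x) 0 = 0 := by
      unfold mwd
      refine integral_eq_zero_of_ae (ae_of_all _ fun s => ?_)
      have e : ∀ B : Matrix (Fin d) (Fin d) ℝ,
          A₁₁.mulVec (t • x) + B.mulVec s - t • x = t • w + B.mulVec s := fun B => by
        rw [Matrix.mulVec_smul, hw, smul_sub]; abel
      simp only [← hcol, e, φ.toComplexSchwartz_apply, Complex.conj_ofReal, Pi.zero_apply]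
      rw [mul_assoc, ← Complex.ofReal_mul, hvanish s, Complex.ofReal_zero, mul_zero]
    rw [hleft, Complex.zero_re] at h
    have hc := eq_zero_of_integral_eq_zero_of_nonneg (by have := φ.continuous; fun_prop)
      (fun s => mul_nonneg φ.nonneg φ.nonneg) (integrable φ 0) h.symm 0
    have hφ0 : φ 0 = 1 := φ.one_of_mem_closedBall (by simpa using φ.rIn_pos.le)
    simp only [mulVec_zero, add_zero, hφ0, mul_one] at hc
    exact one_ne_zero hc
  refine ⟨A₂₂ + (2⁻¹ : ℝ) • 1, hone, hcol ▸ hone, ?_, by abel⟩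
  rw [hdiff, add_assoc, ← add_smul]
  norm_num
end

section
/- Let M be any real d×d matrix and A_M the associated Cohen-type matrix. Then for all Schwartz functions f, g : ℝ^d → ℂ and all ξ, η ∈ ℝ^d, the symplectic Fourier transform of B_{A_M}(f,g) satisfies F_σ B_{A_M}(f,g)(ξ,η) = e^{2πi η·(Mξ)} · Amb(f,g)(ξ,η). -/
open MeasureTheory Matrix ComplexConjugate
open scoped Real Matrix

open scoped SchwartzMap FourierTransform RealInnerProductSpace

section Euclidean

variable {V : Type*} [NormedAddCommGroup V] [InnerProductSpace ℝ V]

lemma SchwartzMap.norm_iteratedFDeriv_comp_const_add_le (f : 𝓢(V, ℂ)) (A : V →L[ℝ] V) (n : ℕ)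
    (x y : V) :
    ‖iteratedFDeriv ℝ n (fun y => f (x + A y)) y‖ ≤
      ‖A‖ ^ n * ‖iteratedFDeriv ℝ n f (x + A y)‖ := by
  have hf : ContDiff ℝ n (fun z => f (x + z)) :=
    (f.smooth n).comp (contDiff_const.add contDiff_id)
  have h := A.iteratedFDeriv_comp_right hf y (i := n) le_rfl
  rw [iteratedFDeriv_comp_add_left] at h
  change ‖iteratedFDeriv ℝ n ((fun z => f (x + z)) ∘ A) y‖ ≤ _
  rw [h, mul_comm]
  refine (ContinuousMultilinearMap.norm_compContinuousLinearMap_le _ _).trans ?_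
  simp

lemma SchwartzMap.exists_one_add_pow_mul_iteratedFDeriv_le (f : 𝓢(V, ℂ)) (k n : ℕ) :
    ∃ C, ∀ x, (1 + ‖x‖) ^ k * ‖iteratedFDeriv ℝ n f x‖ ≤ C :=
  ⟨_, fun x => one_add_le_sup_seminorm_apply (𝕜 := ℝ) (m := (k, n)) le_rfl le_rfl f x⟩

lemma one_add_norm_mul_le {A B : V →L[ℝ] V} (hAB : ∀ y, A y - B y = y) (x y : V) :
    (1 + ‖x‖) * (1 + ‖y‖) ≤ (1 + ‖A‖) * ((1 + ‖x + A y‖) * (1 + ‖x + B y‖)) ^ 2 := by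
  have hy : ‖y‖ ≤ ‖x + A y‖ + ‖x + B y‖ := by
    calc ‖y‖ = ‖(x + A y) - (x + B y)‖ := by rw [add_sub_add_left_eq_sub, hAB]
      _ ≤ _ := norm_sub_le _ _
  have hx : ‖x‖ ≤ ‖x + A y‖ + ‖A‖ * ‖y‖ := by
    calc ‖x‖ = ‖(x + A y) - A y‖ := by rw [add_sub_cancel_right]
      _ ≤ ‖x + A y‖ + ‖A y‖ := norm_sub_le _ _
      _ ≤ _ := by gcongr; exact A.le_opNorm y
  set a := ‖x + A y‖
  set b := ‖x + B y‖
  have ha : 0 ≤ a := norm_nonneg _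
  have hb : 0 ≤ b := norm_nonneg _
  have hA : 0 ≤ ‖A‖ := norm_nonneg _
  have hab : 0 ≤ a * b := mul_nonneg ha hb
  have h₁ : 1 + ‖y‖ ≤ (1 + a) * (1 + b) := by nlinarith
  have h₂ : 1 + ‖x‖ ≤ (1 + ‖A‖) * ((1 + a) * (1 + b)) := by
    have : ‖A‖ * ‖y‖ ≤ ‖A‖ * ((1 + a) * (1 + b)) := by gcongr; linarith
    nlinarith
  calc (1 + ‖x‖) * (1 + ‖y‖)
      ≤ ((1 + ‖A‖) * ((1 + a) * (1 + b))) * ((1 + a) * (1 + b)) := by gcongr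
    _ = _ := by ring

lemma exists_decay_iteratedFDeriv_affine_mul (f g : 𝓢(V, ℂ)) {A B : V →L[ℝ] V}
    (hAB : ∀ y, A y - B y = y) (N n : ℕ) :
    ∃ C, ∀ x y, ((1 + ‖x‖) * (1 + ‖y‖)) ^ N *
      ‖iteratedFDeriv ℝ n (fun y => f (x + A y) * g (x + B y)) y‖ ≤ C := by
  choose Cf hCf using f.exists_one_add_pow_mul_iteratedFDeriv_le (2 * N)
  choose Cg hCg using g.exists_one_add_pow_mul_iteratedFDeriv_le (2 * N)
  refine ⟨(1 + ‖A‖) ^ N * ∑ i ∈ Finset.range (n + 1),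
    (n.choose i : ℝ) * (‖A‖ ^ i * Cf i) * (‖B‖ ^ (n - i) * Cg (n - i)), fun x y => ?_⟩
  have hf : ContDiff ℝ n (fun y => f (x + A y)) :=
    (f.smooth n).comp (contDiff_const.add A.contDiff)
  have hg : ContDiff ℝ n (fun y => g (x + B y)) :=
    (g.smooth n).comp (contDiff_const.add B.contDiff)
  have hw : ((1 + ‖x‖) * (1 + ‖y‖)) ^ N ≤
      (1 + ‖A‖) ^ N * ((1 + ‖x + A y‖) ^ (2 * N) * (1 + ‖x + B y‖) ^ (2 * N)) := by
    calc _ ≤ ((1 + ‖A‖) * ((1 + ‖x + A y‖) * (1 + ‖x + B y‖)) ^ 2) ^ N := by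
          exact pow_le_pow_left₀ (by positivity) (one_add_norm_mul_le hAB x y) N
      _ = _ := by rw [mul_pow, ← pow_mul, mul_pow]
  refine (mul_le_mul hw (norm_iteratedFDeriv_mul_le hf hg y le_rfl) (norm_nonneg _)
    (by positivity)).trans ?_
  rw [mul_assoc]
  gcongr
  rw [Finset.mul_sum]
  refine Finset.sum_le_sum fun i _ => ?_
  have h₁ := f.norm_iteratedFDeriv_comp_const_add_le A i x y
  have h₂ := g.norm_iteratedFDeriv_comp_const_add_le B (n - i) x y
  have h₃ := hCf i (x + A y)
  have h₄ := hCg (n - i) (x + B y)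
  calc _ ≤ (1 + ‖x + A y‖) ^ (2 * N) * (1 + ‖x + B y‖) ^ (2 * N) *
        ((n.choose i : ℝ) * (‖A‖ ^ i * ‖iteratedFDeriv ℝ i f (x + A y)‖) *
          (‖B‖ ^ (n - i) * ‖iteratedFDeriv ℝ (n - i) g (x + B y)‖)) := by gcongr
    _ = (n.choose i : ℝ) *
          (‖A‖ ^ i * ((1 + ‖x + A y‖) ^ (2 * N) * ‖iteratedFDeriv ℝ i f (x + A y)‖)) *
          (‖B‖ ^ (n - i) *
            ((1 + ‖x + B y‖) ^ (2 * N) * ‖iteratedFDeriv ℝ (n - i) g (x + B y)‖)) := by ring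
    _ ≤ _ := by
      have : 0 ≤ Cf i := le_trans (by positivity) h₃
      gcongr

/-- The Schwartz function `y ↦ f (x + A y) * g (x + B y)`, where `A - B = 1`. -/
noncomputable def SchwartzMap.affineMul (f g : 𝓢(V, ℂ)) {A B : V →L[ℝ] V}
    (hAB : ∀ y, A y - B y = y) (x : V) : 𝓢(V, ℂ) where
  toFun y := f (x + A y) * g (x + B y)
  smooth' := ((f.smooth ⊤).comp (contDiff_const.add A.contDiff)).mul
    ((g.smooth ⊤).comp (contDiff_const.add B.contDiff))
  decay' k n := by
    obtain ⟨C, hC⟩ := exists_decay_iteratedFDeriv_affine_mul f g hAB k n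
    refine ⟨C, fun y => le_trans ?_ (hC x y)⟩
    gcongr
    nlinarith [norm_nonneg x, norm_nonneg y, mul_nonneg (norm_nonneg x) (norm_nonneg y)]

lemma SchwartzMap.affineMul_apply (f g : 𝓢(V, ℂ)) {A B : V →L[ℝ] V}
    (hAB : ∀ y, A y - B y = y) (x y : V) :
    f.affineMul g hAB x y = f (x + A y) * g (x + B y) := rfl

variable [FiniteDimensional ℝ V] [MeasurableSpace V] [BorelSpace V]

lemma integrable_one_add_norm_pow_inv {N : ℕ} (hN : Module.finrank ℝ V < N) :
    Integrable (fun x : V => ((1 + ‖x‖) ^ N)⁻¹) := by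
  have := integrable_one_add_norm (E := V) (μ := volume) (r := N) (by exact_mod_cast hN)
  refine this.congr (.of_forall fun x => ?_)
  simp only
  rw [Real.rpow_neg (by positivity), Real.rpow_natCast]

lemma exists_norm_fourier_affineMul_le (f g : 𝓢(V, ℂ)) {A B : V →L[ℝ] V}
    (hAB : ∀ y, A y - B y = y) {N : ℕ} (hN : Module.finrank ℝ V < N) :
    ∃ C, ∀ x w, ‖𝓕 (f.affineMul g hAB x) w‖ ≤
      C * (((1 + ‖x‖) ^ N)⁻¹ * ((1 + ‖w‖) ^ N)⁻¹) := by
  choose C hC using exists_decay_iteratedFDeriv_affine_mul f g hAB N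
  set J : ℝ := ∫ v : V, ((1 + ‖v‖) ^ N)⁻¹
  have hint (n : ℕ) (x : V) : ∫ v, ‖iteratedFDeriv ℝ n (f.affineMul g hAB x) v‖ ≤
      C n * J * ((1 + ‖x‖) ^ N)⁻¹ := by
    have hle : ∀ v, ‖iteratedFDeriv ℝ n (f.affineMul g hAB x) v‖ ≤
        (C n * ((1 + ‖x‖) ^ N)⁻¹) * ((1 + ‖v‖) ^ N)⁻¹ := fun v => by
      have := hC n x v
      rw [mul_assoc, ← mul_inv, ← mul_pow, ← div_eq_mul_inv, le_div_iff₀' (by positivity)]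
      exact this
    calc _ ≤ ∫ v, (C n * ((1 + ‖x‖) ^ N)⁻¹) * ((1 + ‖v‖) ^ N)⁻¹ :=
          integral_mono_of_nonneg (.of_forall fun _ => norm_nonneg _)
            ((integrable_one_add_norm_pow_inv hN).const_mul _) (.of_forall hle)
      _ = _ := by rw [integral_const_mul]; ring
  have hpow (n : ℕ) (x w : V) : ‖w‖ ^ n * ‖𝓕 (f.affineMul g hAB x) w‖ ≤
      2 ^ n * ∑ p ∈ Finset.range (n + 1), C p * J * ((1 + ‖x‖) ^ N)⁻¹ := by
    have h := Real.pow_mul_norm_iteratedFDeriv_fourier_le (K := ⊤) (N := ⊤)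
      ((f.affineMul g hAB x).smooth ⊤)
      (fun k n _ _ => (f.affineMul g hAB x).integrable_pow_mul_iteratedFDeriv volume k n)
      (k := 0) (n := n) le_top le_top w
    simp only [norm_iteratedFDeriv_zero, ← SchwartzMap.fourier_coe] at h
    refine h.trans ?_
    simp only [zero_add, Finset.range_one, Finset.sum_product, Finset.sum_singleton, pow_zero,
      one_mul, Nat.cast_zero, mul_zero]
    gcongr
    exact hint _ _
  refine ⟨2 ^ (N - 1) * (2 ^ 0 * ∑ p ∈ Finset.range (0 + 1), C p * J +
    2 ^ N * ∑ p ∈ Finset.range (N + 1), C p * J), fun x w => ?_⟩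
  have h₀ := hpow 0 x w
  have h₁ := hpow N x w
  rw [← Finset.sum_mul] at h₀ h₁
  rw [← mul_assoc, ← div_eq_mul_inv, le_div_iff₀' (by positivity)]
  calc _ ≤ (2 ^ (N - 1) * (1 ^ N + ‖w‖ ^ N)) * ‖𝓕 (f.affineMul g hAB x) w‖ := by
        gcongr; exact add_pow_le zero_le_one (norm_nonneg w) N
    _ = 2 ^ (N - 1) * (‖w‖ ^ 0 * ‖𝓕 (f.affineMul g hAB x) w‖ +
          ‖w‖ ^ N * ‖𝓕 (f.affineMul g hAB x) w‖) := by ring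
    _ ≤ _ := by rw [mul_assoc (2 ^ (N - 1) : ℝ), add_mul, mul_assoc, mul_assoc]; gcongr

lemma integrable_fourier_affineMul (f g : 𝓢(V, ℂ)) {A B : V →L[ℝ] V}
    (hAB : ∀ y, A y - B y = y) :
    Integrable (fun w : V × V => 𝓕 (f.affineMul g hAB w.1) w.2) := by
  obtain ⟨C, hC⟩ := exists_norm_fourier_affineMul_le f g hAB
    (Nat.lt_succ_self (Module.finrank ℝ V))
  have h := integrable_one_add_norm_pow_inv (V := V) (Nat.lt_succ_self (Module.finrank ℝ V))
  refine ((h.mul_prod h).const_mul C).mono' ?_ (.of_forall fun w => hC w.1 w.2)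
  have : Continuous fun p : (V × V) × V =>
      𝐞 (-⟪p.2, p.1.2⟫) • (f (p.1.1 + A p.2) * g (p.1.1 + B p.2)) := by
    have := f.continuous
    have := g.continuous
    have := Real.continuous_fourierChar
    fun_prop
  have hm := this.stronglyMeasurable.integral_prod_right' (ν := volume)
  refine hm.aestronglyMeasurable.congr (.of_forall fun w => ?_)
  simp only
  rw [SchwartzMap.fourier_coe, Real.fourier_eq]
  rfl

theorem integral_fourierChar_smul_fourier_affineMul (f g : 𝓢(V, ℂ)) {A B : V →L[ℝ] V}
    (hAB : ∀ y, A y - B y = y) (ξ η : V) :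
    ∫ w : V × V, 𝐞 (-(⟪w.1, η⟫ - ⟪w.2, ξ⟫)) • 𝓕 (f.affineMul g hAB w.1) w.2 =
      ∫ x : V, 𝐞 (-⟪x, η⟫) • (f (x + A ξ) * g (x + B ξ)) := by
  have hint : Integrable (fun w : V × V =>
      𝐞 (-(⟪w.1, η⟫ - ⟪w.2, ξ⟫)) • 𝓕 (f.affineMul g hAB w.1) w.2) := by
    refine (integrable_fourier_affineMul f g hAB).mono ?_ (.of_forall fun w => by simp)
    have hc : Continuous fun w : V × V => 𝐞 (-(⟪w.1, η⟫ - ⟪w.2, ξ⟫)) := by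
      have := Real.continuous_fourierChar
      fun_prop
    exact hc.aestronglyMeasurable.smul (integrable_fourier_affineMul f g hAB).1
  rw [Measure.volume_eq_prod, integral_prod _ (by rwa [Measure.volume_eq_prod] at hint)]
  refine integral_congr_ae (.of_forall fun x => ?_)
  simp only
  rw [← SchwartzMap.affineMul_apply f g hAB x ξ]
  conv_rhs => rw [← FourierTransform.fourierInv_fourier_eq (F := 𝓢(V, ℂ)) (f.affineMul g hAB x)]
  rw [SchwartzMap.fourierInv_coe, Real.fourierInv_eq, Circle.smul_def, ← integral_smul]
  refine integral_congr_ae (.of_forall fun w => ?_)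
  simp only [Circle.smul_def, smul_smul]
  rw [neg_sub, sub_eq_neg_add, AddChar.map_add_eq_mul, Circle.coe_mul]

end Euclidean

section Coordinates

variable {d : ℕ}

/-- A Schwartz function on `Fin d → ℝ` viewed as a Schwartz function on Euclidean space. -/
noncomputable def SchwartzMap.toEuclidean (f : 𝓢(Fin d → ℝ, ℂ)) : 𝓢(EuclideanSpace ℝ (Fin d), ℂ) :=
  compCLMOfContinuousLinearEquiv ℝ (EuclideanSpace.equiv (Fin d) ℝ) f

lemma SchwartzMap.toEuclidean_toLp (f : 𝓢(Fin d → ℝ, ℂ)) (x : Fin d → ℝ) :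
    f.toEuclidean (WithLp.toLp 2 x) = f x := rfl

/-- The complex conjugate of a Schwartz function. -/
noncomputable def SchwartzMap.conj {V : Type*} [NormedAddCommGroup V] [NormedSpace ℝ V]
    (f : 𝓢(V, ℂ)) : 𝓢(V, ℂ) :=
  f.postcompCLM (Complex.conjCLE : ℂ →L[ℝ] ℂ)

lemma SchwartzMap.conj_apply {V : Type*} [NormedAddCommGroup V] [NormedSpace ℝ V]
    (f : 𝓢(V, ℂ)) (x : V) : f.conj x = starRingEnd ℂ (f x) := rfl

lemma inner_toLp_toLp (x y : Fin d → ℝ) :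
    ⟪(WithLp.toLp 2 x : EuclideanSpace ℝ (Fin d)), WithLp.toLp 2 y⟫ = x ⬝ᵥ y := by
  rw [EuclideanSpace.inner_toLp_toLp, star_trivial, dotProduct_comm]

lemma coe_fourierChar_neg (t : ℝ) :
    (𝐞 (-t) : ℂ) = Complex.exp (-2 * (Real.pi : ℂ) * Complex.I * (t : ℂ)) := by
  rw [Real.fourierChar_apply]
  congr 1
  push_cast
  ring

lemma toEuclideanCLM_cohen_sub (M : Matrix (Fin d) (Fin d) ℝ) (y : EuclideanSpace ℝ (Fin d)) :
    toEuclideanCLM (𝕜 := ℝ) (M + (2⁻¹ : ℝ) • 1) y -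
      toEuclideanCLM (𝕜 := ℝ) (M - (2⁻¹ : ℝ) • 1) y = y := by
  rw [← _root_.sub_apply, ← map_sub, add_sub_sub_cancel, ← add_smul]
  norm_num

lemma mwd_cohen_eq_fourier (M : Matrix (Fin d) (Fin d) ℝ) (f g : 𝓢(Fin d → ℝ, ℂ))
    (x ω : Fin d → ℝ) :
    mwd 1 (M + (2⁻¹ : ℝ) • 1) 1 (M - (2⁻¹ : ℝ) • 1) f g x ω =
      𝓕 (f.toEuclidean.affineMul g.conj.toEuclidean (toEuclideanCLM_cohen_sub M)
        (WithLp.toLp 2 x)) (WithLp.toLp 2 ω) := by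
  rw [SchwartzMap.fourier_coe, Real.fourier_eq,
    ← (PiLp.volume_preserving_toLp (Fin d)).integral_comp
    (MeasurableEquiv.toLp 2 _).measurableEmbedding, mwd]
  refine integral_congr_ae (.of_forall fun y => ?_)
  simp only [Circle.smul_def, smul_eq_mul, coe_fourierChar_neg, inner_toLp_toLp,
    SchwartzMap.affineMul_apply, toEuclideanCLM_toLp, ← WithLp.toLp_add,
    SchwartzMap.toEuclidean_toLp, SchwartzMap.conj_apply, one_mulVec]
  rw [dotProduct_comm, mul_assoc]

end Coordinates

/-- The symplectic Fourier transform of the Cohen-type matrix-Wigner distribution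
`B_{A_M}(f,g)` equals `e^{2πi η·(Mξ)} · Amb(f,g)(ξ,η)`. -/
theorem symplecticFourier_mwd_cohen {d : ℕ} (M : Matrix (Fin d) (Fin d) ℝ)
    (f g : SchwartzMap ((Fin d) → ℝ) ℂ) (ξ η : Fin d → ℝ) :
    (∫ w : (Fin d → ℝ) × (Fin d → ℝ),
        Complex.exp (-2 * (Real.pi : ℂ) * Complex.I * ((w.1 ⬝ᵥ η - w.2 ⬝ᵥ ξ : ℝ) : ℂ)) *
          mwd 1 (M + (2⁻¹ : ℝ) • 1) 1 (M - (2⁻¹ : ℝ) • 1) (⇑f) (⇑g) w.1 w.2)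
    = Complex.exp (2 * (Real.pi : ℂ) * Complex.I * ((η ⬝ᵥ M.mulVec ξ : ℝ) : ℂ)) *
        ∫ y : Fin d → ℝ,
          Complex.exp (-2 * (Real.pi : ℂ) * Complex.I * ((η ⬝ᵥ y : ℝ) : ℂ)) *
            f (y + (2⁻¹ : ℝ) • ξ) * conj (g (y - (2⁻¹ : ℝ) • ξ)) := by
  let e : (Fin d → ℝ) ≃ᵐ EuclideanSpace ℝ (Fin d) := MeasurableEquiv.toLp 2 (Fin d → ℝ)
  have he : MeasurePreserving e := PiLp.volume_preserving_toLp (Fin d)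
  have hee : MeasurePreserving (e.prodCongr e) volume volume := he.prod he
  have key := integral_fourierChar_smul_fourier_affineMul f.toEuclidean g.conj.toEuclidean
    (toEuclideanCLM_cohen_sub M) (WithLp.toLp 2 ξ) (WithLp.toLp 2 η)
  rw [← hee.integral_comp (e.prodCongr e).measurableEmbedding,
    ← he.integral_comp e.measurableEmbedding] at key
  have hepair (w : (Fin d → ℝ) × (Fin d → ℝ)) :
      e.prodCongr e w = (WithLp.toLp 2 w.1, WithLp.toLp 2 w.2) := rfl
  simp only [hepair, e, MeasurableEquiv.coe_toLp, Circle.smul_def, smul_eq_mul,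
    coe_fourierChar_neg, inner_toLp_toLp, ← mwd_cohen_eq_fourier, toEuclideanCLM_toLp,
    ← WithLp.toLp_add, SchwartzMap.toEuclidean_toLp, SchwartzMap.conj_apply] at key
  refine key.trans ?_
  conv_rhs => rw [← integral_add_right_eq_self _ (M.mulVec ξ), ← integral_const_mul]
  refine integral_congr_ae (.of_forall fun x => ?_)
  simp only [add_mulVec, sub_mulVec, smul_mulVec, one_mulVec, add_assoc, add_sub_assoc]
  rw [← mul_assoc, ← mul_assoc, ← mul_assoc, ← Complex.exp_add, dotProduct_add,
    dotProduct_comm x η]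
  congr 3
  push_cast
  ring
end

section
/- Let M be a real d×d matrix, A_M the associated Cohen-type matrix, λ > 0, and φ_λ(t) = e^{-π|t|²/λ} for t ∈ ℝ^d. Set S = I + 4MᵀM, a symmetric positive-definite d×d matrix (hence invertible with det S > 0). Then for all x, ω ∈ ℝ^d: B_{A_M}(φ_λ, φ_λ)(x,ω) = (2λ)^{d/2} (det S)^{-1/2} · e^{-2π|x|²/λ} · e^{(8π/λ)(Mᵀx)·(S^{-1}Mᵀx)} · e^{8πi (S^{-1}ω)·(Mᵀx)} · e^{-2πλ ω·S^{-1}ω}. -/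
open MeasureTheory Matrix ComplexConjugate
open scoped Real Matrix

/-- A linear substitution rescales the Lebesgue integral on `ι → ℝ` by the inverse determinant. -/
theorem integral_comp_mulVec {ι E : Type*} [Fintype ι] [DecidableEq ι] [NormedAddCommGroup E]
    [NormedSpace ℝ E] (R : Matrix ι ι ℝ) (hR : R.det ≠ 0) (g : (ι → ℝ) → E) :
    ∫ y, g (R *ᵥ y) = |R.det|⁻¹ • ∫ y, g y := by
  have hu : IsUnit R := (R.isUnit_iff_isUnit_det).2 (isUnit_iff_ne_zero.2 hR)
  have hcont : Continuous fun y : ι → ℝ => R *ᵥ y := by fun_prop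
  have hemb : MeasurableEmbedding fun y : ι → ℝ => R *ᵥ y :=
    hcont.measurableEmbedding (Matrix.mulVec_injective_of_isUnit hu)
  have hmap := Real.map_matrix_volume_pi_eq_smul_volume_pi hR
  rw [← hemb.integral_map g]
  change ∫ y, g y ∂(Measure.map (toLin' R) volume) = _
  rw [hmap, integral_smul_measure, ENNReal.toReal_ofReal (abs_nonneg _), abs_inv]

/-- The Gaussian integral with quadratic form `S` and linear term `α p + β q`. -/
theorem integral_cexp_neg_quadForm_add {ι : Type*} [Fintype ι] [DecidableEq ι]
    {S : Matrix ι ι ℝ} (hS : S.PosDef) {b : ℝ} (hb : 0 < b) (α β : ℂ) (p q : ι → ℝ) :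
    ∫ y : ι → ℝ, Complex.exp (-b * ((y ⬝ᵥ S *ᵥ y : ℝ) : ℂ) +
        (α * ((p ⬝ᵥ y : ℝ) : ℂ) + β * ((q ⬝ᵥ y : ℝ) : ℂ))) =
      (((π / b) ^ ((Fintype.card ι : ℝ) / 2) * S.det ^ (-(2⁻¹ : ℝ)) : ℝ) : ℂ) *
        Complex.exp ((α ^ 2 * ((p ⬝ᵥ S⁻¹ *ᵥ p : ℝ) : ℂ) + 2 * α * β * ((q ⬝ᵥ S⁻¹ *ᵥ p : ℝ) : ℂ) +
          β ^ 2 * ((q ⬝ᵥ S⁻¹ *ᵥ q : ℝ) : ℂ)) / (4 * b)) := by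
  obtain ⟨R, hSR⟩ : ∃ R : Matrix ι ι ℝ, S = Rᵀ * R := by
    open scoped MatrixOrder Matrix.Norms.L2Operator in
    obtain ⟨R, hR⟩ := CStarAlgebra.nonneg_iff_eq_star_mul_self.mp hS.posSemidef.nonneg
    exact ⟨R, by rw [hR, star_eq_conjTranspose, conjTranspose_eq_transpose_of_trivial]⟩
  have hdet : S.det = R.det ^ 2 := by rw [hSR, det_mul, det_transpose, sq]
  have hR : R.det ≠ 0 := by
    intro h
    exact hS.det_pos.ne' (by rw [hdet, h, zero_pow two_ne_zero])
  have hRu : IsUnit R.det := isUnit_iff_ne_zero.2 hR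
  have hTu : IsUnit (Rᵀ).det := by rwa [det_transpose]
  have hsurj (v : ι → ℝ) : ∃ v', Rᵀ *ᵥ v' = v :=
    ⟨(Rᵀ)⁻¹ *ᵥ v, by rw [mulVec_mulVec, mul_nonsing_inv _ hTu, one_mulVec]⟩
  obtain ⟨p, rfl⟩ := hsurj p
  obtain ⟨q, rfl⟩ := hsurj q
  have hlin (v y : ι → ℝ) : Rᵀ *ᵥ v ⬝ᵥ y = v ⬝ᵥ R *ᵥ y := by
    rw [mulVec_transpose, dotProduct_mulVec]
  have hinv (v w : ι → ℝ) : Rᵀ *ᵥ v ⬝ᵥ S⁻¹ *ᵥ (Rᵀ *ᵥ w) = v ⬝ᵥ w := by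
    rw [hlin, hSR, Matrix.mul_inv_rev, ← mulVec_mulVec, mulVec_mulVec w, nonsing_inv_mul _ hTu,
      one_mulVec, mulVec_mulVec, mul_nonsing_inv _ hRu, one_mulVec]
  have hquad (y : ι → ℝ) : y ⬝ᵥ S *ᵥ y = R *ᵥ y ⬝ᵥ R *ᵥ y := by
    rw [hSR, ← mulVec_mulVec, dotProduct_comm, hlin]
  simp_rw [hinv, hquad, hlin]
  rw [integral_comp_mulVec R hR fun u : ι → ℝ => Complex.exp (-b * ((u ⬝ᵥ u : ℝ) : ℂ) +
        (α * ((p ⬝ᵥ u : ℝ) : ℂ) + β * ((q ⬝ᵥ u : ℝ) : ℂ)))]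
  have key := GaussianFourier.integral_cexp_neg_mul_sum_add (b := (b : ℂ)) (by simpa using hb)
    fun i => α * (p i : ℂ) + β * (q i : ℂ)
  have hfun (u : ι → ℝ) : -(b : ℂ) * ((u ⬝ᵥ u : ℝ) : ℂ) +
        (α * ((p ⬝ᵥ u : ℝ) : ℂ) + β * ((q ⬝ᵥ u : ℝ) : ℂ)) =
      -(b : ℂ) * ∑ i, (u i : ℂ) ^ 2 + ∑ i, (α * (p i : ℂ) + β * (q i : ℂ)) * u i := by
    simp only [dotProduct, Complex.ofReal_sum, Complex.ofReal_mul, Finset.mul_sum,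
      ← Finset.sum_add_distrib]
    exact Finset.sum_congr rfl fun i _ => by ring
  have hsq : ∑ i, (α * (p i : ℂ) + β * (q i : ℂ)) ^ 2 =
      α ^ 2 * ((p ⬝ᵥ p : ℝ) : ℂ) + 2 * α * β * ((q ⬝ᵥ p : ℝ) : ℂ) +
        β ^ 2 * ((q ⬝ᵥ q : ℝ) : ℂ) := by
    simp only [dotProduct, Complex.ofReal_sum, Complex.ofReal_mul, Finset.mul_sum,
      ← Finset.sum_add_distrib]
    exact Finset.sum_congr rfl fun i _ => by ring
  have hpow : S.det ^ (-(2⁻¹ : ℝ)) = |R.det|⁻¹ := by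
    rw [hdet, Real.rpow_neg (sq_nonneg _), inv_eq_one_div (2 : ℝ), ← Real.sqrt_eq_rpow, Real.sqrt_sq_eq_abs]
  simp_rw [hfun]
  rw [key, hsq, hpow, Complex.real_smul, Complex.ofReal_mul,
    Complex.ofReal_cpow (div_pos Real.pi_pos hb).le]
  push_cast
  ring

/-- Perturbed representation of a Gaussian signal: explicit formula for
`B_{A_M}(φ_λ, φ_λ)` with `φ_λ(t) = e^{-π|t|²/λ}` and `S = I + 4MᵀM`. -/
theorem mwd_cohen_gaussian {d : ℕ} (M : Matrix (Fin d) (Fin d) ℝ) (lam : ℝ) (hlam : 0 < lam)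
    (S : Matrix (Fin d) (Fin d) ℝ) (hS : S = 1 + (4 : ℝ) • (Mᵀ * M)) (x ω : Fin d → ℝ) :
    mwd 1 (M + (2⁻¹ : ℝ) • 1) 1 (M - (2⁻¹ : ℝ) • 1)
        (fun t => (Real.exp (-(Real.pi * (t ⬝ᵥ t)) / lam) : ℂ))
        (fun t => (Real.exp (-(Real.pi * (t ⬝ᵥ t)) / lam) : ℂ)) x ω =
      (((2 * lam) ^ ((d : ℝ) / 2) * S.det ^ (-(2⁻¹ : ℝ)) : ℝ) : ℂ) *
        Complex.exp (((-2) * Real.pi * (x ⬝ᵥ x) / lam : ℝ) : ℂ) *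
        Complex.exp (((8 * Real.pi / lam) *
          (Mᵀ.mulVec x ⬝ᵥ S⁻¹.mulVec (Mᵀ.mulVec x)) : ℝ) : ℂ) *
        Complex.exp (8 * (Real.pi : ℂ) * Complex.I *
          ((S⁻¹.mulVec ω ⬝ᵥ Mᵀ.mulVec x : ℝ) : ℂ)) *
        Complex.exp (((-2) * Real.pi * lam * (ω ⬝ᵥ S⁻¹.mulVec ω) : ℝ) : ℂ) := by
  subst hS
  have hpos : (1 + (4 : ℝ) • (Mᵀ * M)).PosDef := by
    refine Matrix.PosDef.one.add_posSemidef (Matrix.PosSemidef.smul ?_ (by norm_num))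
    simpa [Matrix.conjTranspose_eq_transpose_of_trivial] using
      Matrix.posSemidef_conjTranspose_mul_self M
  have hexp (y : Fin d → ℝ) :
      -(π * (((1 : Matrix (Fin d) (Fin d) ℝ) *ᵥ x + (M + (2⁻¹ : ℝ) • 1) *ᵥ y) ⬝ᵥ
          ((1 : Matrix (Fin d) (Fin d) ℝ) *ᵥ x + (M + (2⁻¹ : ℝ) • 1) *ᵥ y))) / lam +
        -(π * (((1 : Matrix (Fin d) (Fin d) ℝ) *ᵥ x + (M - (2⁻¹ : ℝ) • 1) *ᵥ y) ⬝ᵥ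
          ((1 : Matrix (Fin d) (Fin d) ℝ) *ᵥ x + (M - (2⁻¹ : ℝ) • 1) *ᵥ y))) / lam =
      -2 * π * (x ⬝ᵥ x) / lam + (-(π / (2 * lam)) * (y ⬝ᵥ (1 + (4 : ℝ) • (Mᵀ * M)) *ᵥ y) +
        -(4 * π / lam) * (Mᵀ *ᵥ x ⬝ᵥ y)) := by
    have h₁ : Mᵀ *ᵥ x ⬝ᵥ y = x ⬝ᵥ M *ᵥ y := by rw [mulVec_transpose, dotProduct_mulVec]
    have h₂ : y ⬝ᵥ Mᵀ *ᵥ (M *ᵥ y) = M *ᵥ y ⬝ᵥ M *ᵥ y := by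
      rw [mulVec_transpose, dotProduct_comm, dotProduct_mulVec]
    simp only [add_mulVec, sub_mulVec, smul_mulVec, one_mulVec, add_dotProduct, dotProduct_add,
      sub_dotProduct, dotProduct_sub, smul_dotProduct, dotProduct_smul, smul_eq_mul,
      ← mulVec_mulVec, h₁, h₂, dotProduct_comm (M *ᵥ y) x, dotProduct_comm y x,
      dotProduct_comm y (M *ᵥ y)]
    field
  have hintegrand (y : Fin d → ℝ) :
      Complex.exp (-2 * (π : ℂ) * Complex.I * ((ω ⬝ᵥ y : ℝ) : ℂ)) *
        (Real.exp (-(π * (((1 : Matrix (Fin d) (Fin d) ℝ) *ᵥ x + (M + (2⁻¹ : ℝ) • 1) *ᵥ y) ⬝ᵥ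
          ((1 : Matrix (Fin d) (Fin d) ℝ) *ᵥ x + (M + (2⁻¹ : ℝ) • 1) *ᵥ y))) / lam) : ℂ) *
        conj (Real.exp (-(π *
          (((1 : Matrix (Fin d) (Fin d) ℝ) *ᵥ x + (M - (2⁻¹ : ℝ) • 1) *ᵥ y) ⬝ᵥ
          ((1 : Matrix (Fin d) (Fin d) ℝ) *ᵥ x + (M - (2⁻¹ : ℝ) • 1) *ᵥ y))) / lam) : ℂ) =
      Complex.exp ((-2 * π * (x ⬝ᵥ x) / lam : ℝ) : ℂ) *
        Complex.exp (-((π / (2 * lam) : ℝ) : ℂ) *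
            ((y ⬝ᵥ (1 + (4 : ℝ) • (Mᵀ * M)) *ᵥ y : ℝ) : ℂ) +
          (((-(4 * π / lam) : ℝ) : ℂ) * ((Mᵀ *ᵥ x ⬝ᵥ y : ℝ) : ℂ) +
            (-2 * (π : ℂ) * Complex.I) * ((ω ⬝ᵥ y : ℝ) : ℂ))) := by
    rw [Complex.conj_ofReal, mul_assoc, ← Complex.ofReal_mul, ← Real.exp_add, hexp,
      Complex.ofReal_exp, ← Complex.exp_add, ← Complex.exp_add]
    congr 1
    push_cast
    ring
  have hlin : (1 + (4 : ℝ) • (Mᵀ * M))⁻¹ *ᵥ ω ⬝ᵥ Mᵀ *ᵥ x =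
      ω ⬝ᵥ (1 + (4 : ℝ) • (Mᵀ * M))⁻¹ *ᵥ (Mᵀ *ᵥ x) := by
    have hsymm : ((1 + (4 : ℝ) • (Mᵀ * M))⁻¹)ᵀ = (1 + (4 : ℝ) • (Mᵀ * M))⁻¹ := by
      rw [transpose_nonsing_inv]
      simp [transpose_mul]
    rw [dotProduct_mulVec ω, ← mulVec_transpose _ ω, hsymm]
  have hb : π / (π / (2 * lam)) = 2 * lam := by
    field_simp
  unfold mwd
  simp_rw [hintegrand]
  rw [integral_const_mul, integral_cexp_neg_quadForm_add hpos (by positivity), hlin, hb,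
    Fintype.card_fin]
  rw [mul_left_comm, ← mul_assoc]
  simp only [mul_assoc _ (Complex.exp _) (Complex.exp _), ← Complex.exp_add]
  congr 2
  have hlam' : (lam : ℂ) ≠ 0 := by exact_mod_cast hlam.ne'
  have hpi : (π : ℂ) ≠ 0 := by exact_mod_cast Real.pi_ne_zero
  push_cast
  field_simp
  ring_nf
  simp only [Complex.I_sq]
  ring
end

section
/- Let A be a real invertible (2d)×(2d) matrix. Then for all Schwartz functions f, g : ℝ^d → ℂ and all (x,ω) ∈ ℝ^d × ℝ^d, B_A(F f, F g)(x,ω) = |det A|^{-1} · B_C(f,g)(−ω, x), where C = I₂ (A^{-1})ᵀ Ĩ with I₂ = [[I, 0], [0, −I]] and Ĩ = [[0, I], [I, 0]] (I the d×d identity), and F denotes the Fourier transform on ℝ^d. -/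
open MeasureTheory Matrix ComplexConjugate
open scoped Real Matrix

/-- The Fourier transform on `ℝ^d`, normalized as `F f(ω) = ∫ e^{-2πi x·ω} f(x) dx`. -/
noncomputable def ftd {d : ℕ} (f : (Fin d → ℝ) → ℂ) (ω : Fin d → ℝ) : ℂ :=
  ∫ x : Fin d → ℝ,
    Complex.exp (-2 * (Real.pi : ℂ) * Complex.I * ((x ⬝ᵥ ω : ℝ) : ℂ)) * f x

lemma norm_exp_neg_two_pi_I_mul (r : ℝ) :
    ‖Complex.exp (-2 * (Real.pi : ℂ) * Complex.I * (r : ℂ))‖ = 1 := by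
  have h : -2 * (Real.pi : ℂ) * Complex.I * (r : ℂ) = ((-2 * Real.pi * r : ℝ) : ℂ) * Complex.I := by
    push_cast; ring
  rw [h, Complex.norm_exp_ofReal_mul_I]

/-- Rapid decay of a tensor product of Schwartz functions composed with an injective linear map. -/
lemma SchwartzMap.exists_norm_mul_norm_le {E : Type*} [NormedAddCommGroup E] [NormedSpace ℝ E]
    [FiniteDimensional ℝ E] (f g : SchwartzMap E ℂ) (L : E × E →ₗ[ℝ] E × E)
    (hL : Function.Injective L) (k : ℕ) :
    ∃ C : ℝ, 0 ≤ C ∧ ∀ z, ‖f (L z).1‖ * ‖g (L z).2‖ ≤ C * (1 + ‖z‖) ^ (-(k : ℝ)) := by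
  obtain ⟨K, -, hK⟩ := L.exists_antilipschitzWith (LinearMap.ker_eq_bot.2 hL)
  have hdecay (h : SchwartzMap E ℂ) : ∃ C : ℝ, 0 ≤ C ∧ ∀ x, (1 + ‖x‖) ^ k * ‖h x‖ ≤ C := by
    refine ⟨_, ?_, fun x => by
      simpa using SchwartzMap.one_add_le_sup_seminorm_apply (𝕜 := ℝ) (m := (k, 0)) le_rfl le_rfl h x⟩
    positivity
  obtain ⟨Cf, hCf, hf⟩ := hdecay f
  obtain ⟨Cg, hCg, hg⟩ := hdecay g
  refine ⟨(1 + K) ^ k * (Cf * Cg), by positivity, fun z => ?_⟩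
  have hz : ‖z‖ ≤ K * ‖L z‖ := by simpa using hK.le_mul_dist z 0
  have hmax : 1 + ‖L z‖ ≤ (1 + ‖(L z).1‖) * (1 + ‖(L z).2‖) := by
    rw [Prod.norm_def]
    rcases max_choice ‖(L z).1‖ ‖(L z).2‖ with h | h <;> rw [h] <;>
      nlinarith [norm_nonneg (L z).1, norm_nonneg (L z).2,
        mul_nonneg (norm_nonneg (L z).1) (norm_nonneg (L z).2)]
  have hbound : 1 + ‖z‖ ≤ (1 + K) * ((1 + ‖(L z).1‖) * (1 + ‖(L z).2‖)) := by
    have hK0 : (0 : ℝ) ≤ K := K.2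
    nlinarith [norm_nonneg (L z)]
  rw [Real.rpow_neg (by positivity), Real.rpow_natCast, ← div_eq_mul_inv,
    le_div_iff₀ (by positivity)]
  calc ‖f (L z).1‖ * ‖g (L z).2‖ * (1 + ‖z‖) ^ k
      ≤ ‖f (L z).1‖ * ‖g (L z).2‖ * ((1 + K) * ((1 + ‖(L z).1‖) * (1 + ‖(L z).2‖))) ^ k := by
        gcongr
    _ = (1 + K) ^ k * (((1 + ‖(L z).1‖) ^ k * ‖f (L z).1‖) *
          ((1 + ‖(L z).2‖) ^ k * ‖g (L z).2‖)) := by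
        rw [mul_pow, mul_pow]; ring
    _ ≤ _ := by
        gcongr
        · exact hf _
        · exact hg _

lemma ftd_eq_fourier {d : ℕ} (f : (Fin d → ℝ) → ℂ) (ω : EuclideanSpace ℝ (Fin d)) :
    ftd f ω.ofLp = FourierTransform.fourier
      (fun v : EuclideanSpace ℝ (Fin d) => f v.ofLp) ω := by
  rw [Real.fourier_eq', ftd, ← (PiLp.volume_preserving_ofLp (Fin d)).integral_comp
    (MeasurableEquiv.toLp 2 (Fin d → ℝ)).symm.measurableEmbedding]
  refine integral_congr_ae (Filter.Eventually.of_forall fun v => ?_)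
  simp only [smul_eq_mul, EuclideanSpace.inner_eq_star_dotProduct, star_trivial]
  rw [dotProduct_comm]
  congr 2
  push_cast
  ring

/-- The Fourier transform of a Schwartz function is a Schwartz function. -/
lemma exists_schwartzMap_eq_ftd {d : ℕ} (f : SchwartzMap (Fin d → ℝ) ℂ) :
    ∃ h : SchwartzMap (Fin d → ℝ) ℂ, ⇑h = ftd ⇑f := by
  let e : EuclideanSpace ℝ (Fin d) ≃L[ℝ] (Fin d → ℝ) := PiLp.continuousLinearEquiv 2 ℝ _
  refine ⟨SchwartzMap.compCLMOfContinuousLinearEquiv ℂ e.symm (FourierTransform.fourier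
    (SchwartzMap.compCLMOfContinuousLinearEquiv ℂ e f)), funext fun ω => ?_⟩
  have h := ftd_eq_fourier ⇑f (WithLp.toLp 2 ω)
  rw [WithLp.ofLp_toLp] at h
  rw [h, SchwartzMap.compCLMOfContinuousLinearEquiv_apply, SchwartzMap.fourier_coe]
  rfl

/-- Fourier inversion, evaluated at the reflected point. -/
lemma integral_exp_mul_ftd {d : ℕ} {G : (Fin d → ℝ) → ℂ} (hc : Continuous G) (hi : Integrable G)
    (hFi : Integrable (ftd G)) (ω : Fin d → ℝ) :
    ∫ y : Fin d → ℝ, Complex.exp (-2 * (Real.pi : ℂ) * Complex.I * ((ω ⬝ᵥ y : ℝ) : ℂ)) * ftd G y =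
      G (-ω) := by
  have hmp := PiLp.volume_preserving_ofLp (Fin d)
  have hemb := (MeasurableEquiv.toLp 2 (Fin d → ℝ)).symm.measurableEmbedding
  have hF : FourierTransform.fourier (fun v : EuclideanSpace ℝ (Fin d) => G v.ofLp) =
      fun v => ftd G v.ofLp := funext fun v => (ftd_eq_fourier G v).symm
  have h := congrFun (Continuous.fourierInv_fourier_eq
    (f := fun v : EuclideanSpace ℝ (Fin d) => G v.ofLp)
    (hc.comp (PiLp.continuous_ofLp 2 _)) ((hmp.integrable_comp_emb hemb).2 hi)
    (hF ▸ (hmp.integrable_comp_emb hemb).2 hFi)) (WithLp.toLp 2 (-ω))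
  rw [hF, Real.fourierInv_eq'] at h
  rw [← h, ← hmp.integral_comp hemb]
  refine integral_congr_ae (Filter.Eventually.of_forall fun v => ?_)
  simp only [smul_eq_mul, EuclideanSpace.inner_eq_star_dotProduct, star_trivial, neg_dotProduct]
  congr 2
  push_cast
  ring

/-- The matrix-Wigner identity for linear maps `T` and `N` such that `N` is the inverse adjoint of
`T` up to a reflection of the second component. -/
lemma integral_ftd_mul_conj_ftd {d : ℕ} (f g : SchwartzMap (Fin d → ℝ) ℂ)
    (T N : (Fin d → ℝ) × (Fin d → ℝ) →ₗ[ℝ] (Fin d → ℝ) × (Fin d → ℝ))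
    (hT : Function.Injective T) (hN : LinearMap.det N ≠ 0)
    (hTN : ∀ z w, (N w).1 ⬝ᵥ (T z).1 - (N w).2 ⬝ᵥ (T z).2 = z.1 ⬝ᵥ w.1 + w.2 ⬝ᵥ z.2)
    (x ω : Fin d → ℝ) :
    ∫ y : Fin d → ℝ, Complex.exp (-2 * (Real.pi : ℂ) * Complex.I * ((ω ⬝ᵥ y : ℝ) : ℂ)) *
        ftd ⇑f (T (x, y)).1 * conj (ftd ⇑g (T (x, y)).2) =
      (|LinearMap.det N| : ℝ) * ∫ t : Fin d → ℝ,
        Complex.exp (-2 * (Real.pi : ℂ) * Complex.I * ((x ⬝ᵥ t : ℝ) : ℂ)) *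
          f (N (t, -ω)).1 * conj (g (N (t, -ω)).2) := by
  have hNe : MeasurableEmbedding N :=
    (LinearMap.equivOfDetNeZero N hN).toContinuousLinearEquiv.toHomeomorph.measurableEmbedding
  have hNi : Function.Injective N := (LinearMap.equivOfDetNeZero N hN).injective
  have hNc : Continuous N := N.continuous_of_finiteDimensional
  have hTc : Continuous T := T.continuous_of_finiteDimensional
  obtain ⟨hf, hf'⟩ := exists_schwartzMap_eq_ftd f
  obtain ⟨hg, hg'⟩ := exists_schwartzMap_eq_ftd g
  set k : ℕ := Module.finrank ℝ ((Fin d → ℝ) × (Fin d → ℝ)) + 1 with hk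
  have hk1 : (Module.finrank ℝ (Fin d → ℝ) : ℝ) < k := by
    rw [hk, Module.finrank_prod]; push_cast; linarith [Nat.cast_nonneg (α := ℝ)
      (Module.finrank ℝ (Fin d → ℝ))]
  obtain ⟨C, hC0, hC⟩ := f.exists_norm_mul_norm_le g N hNi k
  obtain ⟨D, hD0, hD⟩ := hf.exists_norm_mul_norm_le hg T hT k
  have hpow {z : (Fin d → ℝ) × (Fin d → ℝ)} {t : Fin d → ℝ} (h : ‖t‖ ≤ ‖z‖) :
      (1 + ‖z‖) ^ (-(k : ℝ)) ≤ (1 + ‖t‖) ^ (-(k : ℝ)) :=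
    Real.rpow_le_rpow_of_nonpos (by positivity) (by linarith) (by simp)
  have hHaar : (volume.prod volume : Measure ((Fin d → ℝ) × (Fin d → ℝ))).IsAddHaarMeasure :=
    Measure.prod.instIsAddHaarMeasure _ _
  let P : (Fin d → ℝ) × (Fin d → ℝ) → ℂ := fun z =>
    Complex.exp (-2 * (Real.pi : ℂ) * Complex.I * ((x ⬝ᵥ z.1 : ℝ) : ℂ)) *
      f (N z).1 * conj (g (N z).2)
  have hPc : Continuous P := by
    have := f.continuous
    have := g.continuous
    fun_prop
  have hPn (z) : ‖P z‖ ≤ C * (1 + ‖z‖) ^ (-(k : ℝ)) := by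
    simpa only [P, norm_mul, norm_exp_neg_two_pi_I_mul, one_mul, RCLike.norm_conj] using hC z
  have hPi : Integrable P (volume.prod volume) :=
    ((integrable_one_add_norm (by simp [hk])).const_mul C).mono' hPc.aestronglyMeasurable
      (Filter.Eventually.of_forall hPn)
  let G : (Fin d → ℝ) → ℂ := fun s => ∫ t, P (t, s)
  have hGc : Continuous G := by
    refine continuous_of_dominated (bound := fun t => C * (1 + ‖t‖) ^ (-(k : ℝ)))
      (fun s => Continuous.aestronglyMeasurable (by fun_prop))
      (fun s => Filter.Eventually.of_forall fun t => (hPn _).trans ?_)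
      ((integrable_one_add_norm hk1).const_mul C)
      (Filter.Eventually.of_forall fun t => by fun_prop)
    exact mul_le_mul_of_nonneg_left (hpow (le_max_left _ _)) hC0
  have hGi : Integrable G := hPi.integral_prod_right
  have hGF (y : Fin d → ℝ) : ftd G y = ((|(LinearMap.det N)⁻¹| : ℝ) : ℂ) *
      (ftd ⇑f (T (x, y)).1 * conj (ftd ⇑g (T (x, y)).2)) := by
    let H : (Fin d → ℝ) × (Fin d → ℝ) → ℂ := fun w =>
      (Complex.exp (-2 * (Real.pi : ℂ) * Complex.I * ((w.1 ⬝ᵥ (T (x, y)).1 : ℝ) : ℂ)) * f w.1) *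
      conj (Complex.exp (-2 * (Real.pi : ℂ) * Complex.I * ((w.2 ⬝ᵥ (T (x, y)).2 : ℝ) : ℂ)) * g w.2)
    have hHN (z : (Fin d → ℝ) × (Fin d → ℝ)) :
        Complex.exp (-2 * (Real.pi : ℂ) * Complex.I * ((z.2 ⬝ᵥ y : ℝ) : ℂ)) * P z = H (N z) := by
      have h := hTN (x, y) z
      simp only [P, H, map_mul, ← Complex.exp_conj, Complex.conj_ofReal, Complex.conj_I, map_neg,
        map_ofNat]
      have hexp : Complex.exp (-2 * (Real.pi : ℂ) * Complex.I * ((z.2 ⬝ᵥ y : ℝ) : ℂ)) *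
          Complex.exp (-2 * (Real.pi : ℂ) * Complex.I * ((x ⬝ᵥ z.1 : ℝ) : ℂ)) =
          Complex.exp (-2 * (Real.pi : ℂ) * Complex.I *
            (((N z).1 ⬝ᵥ (T (x, y)).1 : ℝ) : ℂ)) *
          Complex.exp (-2 * (Real.pi : ℂ) * -Complex.I *
            (((N z).2 ⬝ᵥ (T (x, y)).2 : ℝ) : ℂ)) := by
        rw [← Complex.exp_add, ← Complex.exp_add]
        congr 1
        have h' := congrArg (Complex.ofReal) h
        push_cast at h'
        linear_combination (2 * (Real.pi : ℂ) * Complex.I) * h'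
      linear_combination (f (N z).1 * conj (g (N z).2)) * hexp
    have hEi : Integrable (fun z : (Fin d → ℝ) × (Fin d → ℝ) =>
        Complex.exp (-2 * (Real.pi : ℂ) * Complex.I * ((z.2 ⬝ᵥ y : ℝ) : ℂ)) * P z)
        (volume.prod volume) :=
      hPi.bdd_mul (c := 1) (Continuous.aestronglyMeasurable (by fun_prop))
        (Filter.Eventually.of_forall fun z => (norm_exp_neg_two_pi_I_mul _).le)
    have hmap := integral_prod_symm _ hEi
    calc ftd G y = ∫ s, ∫ t, H (N (t, s)) := by
          rw [ftd]
          refine integral_congr_ae (Filter.Eventually.of_forall fun s => ?_)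
          simp only [G, ← hHN]
          rw [integral_const_mul]
      _ = ∫ z, H (N z) ∂(volume.prod volume) := by
          simp only [← hHN]
          exact hmap.symm
      _ = ∫ w, H w ∂(Measure.map N (volume.prod volume)) := (hNe.integral_map H).symm
      _ = _ := by
          rw [Measure.map_linearMap_addHaar_eq_smul_addHaar _ hN, integral_smul_measure,
            ENNReal.toReal_ofReal (abs_nonneg _), Complex.real_smul]
          congr 1
          rw [ftd, ftd, ← integral_conj]
          exact integral_prod_mul (L := ℂ)
            (fun u => Complex.exp (-2 * (Real.pi : ℂ) * Complex.I *
              ((u ⬝ᵥ (T (x, y)).1 : ℝ) : ℂ)) * f u)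
            (fun v => conj (Complex.exp (-2 * (Real.pi : ℂ) * Complex.I *
              ((v ⬝ᵥ (T (x, y)).2 : ℝ) : ℂ)) * g v))
  have hFi : Integrable (ftd G) := by
    have hprod : Integrable fun y : Fin d → ℝ => hf (T (x, y)).1 * conj (hg (T (x, y)).2) := by
      refine ((integrable_one_add_norm hk1).const_mul D).mono'
        (Continuous.aestronglyMeasurable ?_) (Filter.Eventually.of_forall fun y => ?_)
      · have := hf.continuous
        have := hg.continuous
        fun_prop
      · rw [norm_mul, RCLike.norm_conj]
        exact (hD _).trans (mul_le_mul_of_nonneg_left (hpow (le_max_right _ _)) hD0)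
    rw [hf', hg'] at hprod
    rw [show ftd G = _ from funext hGF]
    exact hprod.const_mul _
  have hinv := integral_exp_mul_ftd hGc hGi hFi ω
  change _ = _ * G (-ω)
  rw [← hinv, ← integral_const_mul]
  refine integral_congr_ae (Filter.Eventually.of_forall fun y => ?_)
  simp only [hGF]
  have hd : ((|LinearMap.det N| : ℝ) : ℂ) * ((|(LinearMap.det N)⁻¹| : ℝ) : ℂ) = 1 := by
    rw [← Complex.ofReal_mul, ← abs_mul, mul_inv_cancel₀ hN, abs_one, Complex.ofReal_one]
  linear_combination (-Complex.exp (-2 * (Real.pi : ℂ) * Complex.I * ((ω ⬝ᵥ y : ℝ) : ℂ)) *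
    (ftd ⇑f (T (x, y)).1 * conj (ftd ⇑g (T (x, y)).2))) * hd

/-- The linear map on pairs of vectors given by a `2 × 2` block matrix. -/
noncomputable def blockLin {d : ℕ} (M : Matrix (Fin d ⊕ Fin d) (Fin d ⊕ Fin d) ℝ) :
    (Fin d → ℝ) × (Fin d → ℝ) →ₗ[ℝ] (Fin d → ℝ) × (Fin d → ℝ) :=
  (LinearEquiv.sumArrowLequivProdArrow (Fin d) (Fin d) ℝ ℝ : _ →ₗ[ℝ] _) ∘ₗ Matrix.toLin' M ∘ₗ
    ((LinearEquiv.sumArrowLequivProdArrow (Fin d) (Fin d) ℝ ℝ).symm : _ →ₗ[ℝ] _)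

lemma det_blockLin {d : ℕ} (M : Matrix (Fin d ⊕ Fin d) (Fin d ⊕ Fin d) ℝ) :
    LinearMap.det (blockLin M) = M.det := by
  rw [blockLin, LinearMap.det_conj, LinearMap.det_toLin']

lemma blockLin_apply {d : ℕ} (M : Matrix (Fin d ⊕ Fin d) (Fin d ⊕ Fin d) ℝ)
    (z : (Fin d → ℝ) × (Fin d → ℝ)) :
    blockLin M z = ((M *ᵥ Sum.elim z.1 z.2) ∘ Sum.inl, (M *ᵥ Sum.elim z.1 z.2) ∘ Sum.inr) := rfl

lemma blockLin_fromBlocks {d : ℕ} (A B C D : Matrix (Fin d) (Fin d) ℝ)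
    (z : (Fin d → ℝ) × (Fin d → ℝ)) :
    blockLin (fromBlocks A B C D) z = (A *ᵥ z.1 + B *ᵥ z.2, C *ᵥ z.1 + D *ᵥ z.2) := by
  simp [blockLin_apply, fromBlocks_mulVec]

/-- Fundamental-like identity: `B_A(F f, F g)(x,ω) = |det A|⁻¹ B_C(f,g)(−ω, x)` with
`C = I₂ (A⁻¹)ᵀ Ĩ`. -/
theorem mwd_fourier_args {d : ℕ} (A₁₁ A₁₂ A₂₁ A₂₂ : Matrix (Fin d) (Fin d) ℝ)
    (hA : (Matrix.fromBlocks A₁₁ A₁₂ A₂₁ A₂₂).det ≠ 0)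
    (f g : SchwartzMap ((Fin d) → ℝ) ℂ) (x ω : Fin d → ℝ)
    (C : Matrix ((Fin d) ⊕ (Fin d)) ((Fin d) ⊕ (Fin d)) ℝ)
    (hC : C = Matrix.fromBlocks 1 0 0 (-1) * ((Matrix.fromBlocks A₁₁ A₁₂ A₂₁ A₂₂)⁻¹)ᵀ *
        Matrix.fromBlocks 0 1 1 0) :
    mwd A₁₁ A₁₂ A₂₁ A₂₂ (ftd ⇑f) (ftd ⇑g) x ω =
      ((|(Matrix.fromBlocks A₁₁ A₁₂ A₂₁ A₂₂).det|⁻¹ : ℝ) : ℂ) *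
        mwd C.toBlocks₁₁ C.toBlocks₁₂ C.toBlocks₂₁ C.toBlocks₂₂ (⇑f) (⇑g) (-ω) x := by
  set A := fromBlocks A₁₁ A₁₂ A₂₁ A₂₂ with hAdef
  set R : Matrix (Fin d ⊕ Fin d) (Fin d ⊕ Fin d) ℝ := fromBlocks 1 0 0 (-1) with hR
  have hAu : IsUnit A.det := isUnit_iff_ne_zero.2 hA
  have hRdet : |R.det| = 1 := by
    rw [hR, det_fromBlocks_zero₂₁, det_one, one_mul, det_neg, det_one, mul_one, abs_pow]
    simp
  have hdet : |LinearMap.det (blockLin (R * A⁻¹ᵀ))| = |A.det|⁻¹ := by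
    rw [det_blockLin, det_mul, abs_mul, hRdet, one_mul, det_transpose, det_nonsing_inv,
      Ring.inverse_eq_inv', abs_inv]
  have hN : LinearMap.det (blockLin (R * A⁻¹ᵀ)) ≠ 0 := by
    rw [← abs_ne_zero, hdet]
    exact inv_ne_zero (abs_ne_zero.2 hA)
  have hT : Function.Injective (blockLin A) :=
    (LinearMap.equivOfDetNeZero (blockLin A) (by rwa [det_blockLin])).injective
  have hsplit (u v : Fin d ⊕ Fin d → ℝ) :
      (u ∘ Sum.inl) ⬝ᵥ (v ∘ Sum.inl) + (u ∘ Sum.inr) ⬝ᵥ (v ∘ Sum.inr) = u ⬝ᵥ v := by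
    simp [dotProduct, Fintype.sum_sum_type]
  have hTN (z w) : (blockLin (R * A⁻¹ᵀ) w).1 ⬝ᵥ (blockLin A z).1 -
      (blockLin (R * A⁻¹ᵀ) w).2 ⬝ᵥ (blockLin A z).2 = z.1 ⬝ᵥ w.1 + w.2 ⬝ᵥ z.2 := by
    have h : (A⁻¹ᵀ *ᵥ Sum.elim w.1 w.2) ⬝ᵥ (A *ᵥ Sum.elim z.1 z.2) =
        Sum.elim w.1 w.2 ⬝ᵥ Sum.elim z.1 z.2 := by
      rw [mulVec_transpose, ← dotProduct_mulVec, mulVec_mulVec, nonsing_inv_mul _ hAu, one_mulVec]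
    rw [← hsplit, ← hsplit] at h
    simp only [Sum.elim_comp_inl, Sum.elim_comp_inr] at h
    rw [dotProduct_comm z.1, ← h]
    simp [blockLin_apply, ← mulVec_mulVec, hR, fromBlocks_mulVec, neg_mulVec]
  have hCN (t : Fin d → ℝ) : blockLin (R * A⁻¹ᵀ) (t, -ω) =
      (C.toBlocks₁₁ *ᵥ (-ω) + C.toBlocks₁₂ *ᵥ t, C.toBlocks₂₁ *ᵥ (-ω) + C.toBlocks₂₂ *ᵥ t) := by
    have h : blockLin C (-ω, t) = blockLin (R * A⁻¹ᵀ) (t, -ω) := by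
      simp [hC, blockLin_apply, ← mulVec_mulVec, fromBlocks_mulVec]
    rw [← h, ← blockLin_fromBlocks _ _ _ _ (-ω, t), fromBlocks_toBlocks]
  have hmain := integral_ftd_mul_conj_ftd f g _ _ hT hN hTN x ω
  simp only [hdet, hCN] at hmain
  simpa only [mwd, hAdef, blockLin_fromBlocks] using hmain
end

section
/- Let A be a real invertible (2d)×(2d) matrix that is right-regular (A₁₂ and A₂₂ invertible), and let (e_n)_{n∈ℕ} be an orthonormal (Hilbert) basis of L²(ℝ^d; ℂ). Then the doubly-indexed family ((m,n) ↦ |det A|^{1/2} · B_A(e_m, e_n))_{(m,n)∈ℕ×ℕ} is an orthonormal (Hilbert) basis of L²(ℝ^{2d}; ℂ). -/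
open MeasureTheory Matrix ComplexConjugate
open scoped Real Matrix

open scoped FourierTransform ENNReal SchwartzMap

theorem lintegral_enorm_sq_eq_eLpNorm_sq {α : Type*} [MeasurableSpace α] {μ : Measure α}
    (h : α → ℂ) : ∫⁻ x, ‖h x‖ₑ ^ 2 ∂μ = eLpNorm h 2 μ ^ 2 := by
  rw [← ENNReal.rpow_natCast]
  simpa using (eLpNorm_nnreal_pow_eq_lintegral (f := h) (μ := μ) (p := 2) (by norm_num)).symm

section Plancherel

variable {E : Type*} [NormedAddCommGroup E] [InnerProductSpace ℝ E] [FiniteDimensional ℝ E]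
  [MeasurableSpace E] [BorelSpace E]

/-- On `L¹ ∩ L²` the `L²`-Fourier transform is given by the Fourier integral. -/
theorem Lp_fourier_toLp_ae_eq {f : E → ℂ} (hf : Integrable f) (hf2 : MemLp f 2) :
    ((𝓕 (hf2.toLp f) : Lp ℂ 2 (volume : Measure E)) : E → ℂ) =ᵐ[volume] 𝓕 f := by
  have hcont : Continuous (𝓕 f) :=
    VectorFourier.fourierIntegral_continuous Real.continuous_fourierChar
      (by exact continuous_inner) hf
  refine ae_eq_of_integral_contDiff_smul_eq
    ((Lp.memLp _).locallyIntegrable (by norm_num)) hcont.locallyIntegrable fun g hg hgs ↦ ?_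
  have hgs' : HasCompactSupport (fun x ↦ (g x : ℂ)) := hgs.comp_left (g := fun r : ℝ ↦ (r : ℂ)) rfl
  let φ : 𝓢(E, ℂ) := hgs'.toSchwartzMap (Complex.ofRealCLM.contDiff.comp hg)
  have hφ (x : E) : φ x = g x := rfl
  have h1 := DFunLike.congr_fun (Lp.fourier_toTemperedDistribution_eq (hf2.toLp f)) φ
  simp only [TemperedDistribution.fourier_apply, Lp.toTemperedDistribution_apply] at h1
  have h2 : ∫ x, (𝓕 φ : 𝓢(E, ℂ)) x • (hf2.toLp f : E → ℂ) x = ∫ x, (𝓕 φ : 𝓢(E, ℂ)) x • f x :=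
    integral_congr_ae (by filter_upwards [hf2.coeFn_toLp] with x hx; rw [hx])
  have h3 := VectorFourier.integral_fourierIntegral_smul_eq_flip (L := innerₗ E)
    (μ := (volume : Measure E)) (ν := volume) Real.continuous_fourierChar
    (by exact continuous_inner) φ.integrable hf
  rw [h2] at h1
  rw [flip_innerₗ] at h3
  simp only [hφ, Complex.real_smul, smul_eq_mul] at h1 h3 ⊢
  rw [← h1]
  exact h3

/-- Plancherel's theorem for functions in `L¹ ∩ L²`. -/
theorem lintegral_enorm_sq_fourier {f : E → ℂ} (hf : Integrable f) (hf2 : MemLp f 2) :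
    ∫⁻ x, ‖𝓕 f x‖ₑ ^ 2 = ∫⁻ x, ‖f x‖ₑ ^ 2 := by
  have h := Lp.norm_fourier_eq (hf2.toLp f)
  rw [Lp.norm_def, Lp.norm_def, ENNReal.toReal_eq_toReal_iff' (Lp.eLpNorm_ne_top _)
    (Lp.eLpNorm_ne_top _), eLpNorm_congr_ae (Lp_fourier_toLp_ae_eq hf hf2),
    eLpNorm_congr_ae hf2.coeFn_toLp] at h
  rw [lintegral_enorm_sq_eq_eLpNorm_sq, lintegral_enorm_sq_eq_eLpNorm_sq, h]

end Plancherel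

section Coordinates

variable {d : ℕ}

theorem integrable_cexp_dotProduct_mul {f : (Fin d → ℝ) → ℂ} (hf : Integrable f)
    (ω : Fin d → ℝ) : Integrable fun y : Fin d → ℝ ↦
      Complex.exp (-2 * (Real.pi : ℂ) * Complex.I * ((ω ⬝ᵥ y : ℝ) : ℂ)) * f y := by
  refine hf.bdd_mul (c := 1) ?_ (.of_forall fun y ↦ ?_)
  · have : Continuous fun y : Fin d → ℝ ↦ ω ⬝ᵥ y := by
      unfold dotProduct
      fun_prop
    exact Continuous.aestronglyMeasurable (by fun_prop)
  · rw [Complex.norm_exp]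
    simp

theorem integral_cexp_dotProduct_eq_fourier (f : (Fin d → ℝ) → ℂ) (ω : Fin d → ℝ) :
    ∫ y : Fin d → ℝ, Complex.exp (-2 * (Real.pi : ℂ) * Complex.I * ((ω ⬝ᵥ y : ℝ) : ℂ)) * f y =
      𝓕 (fun v : EuclideanSpace ℝ (Fin d) ↦ f (WithLp.ofLp v)) (WithLp.toLp 2 ω) := by
  rw [Real.fourier_eq', ← (PiLp.volume_preserving_ofLp (Fin d)).integral_comp
    (MeasurableEquiv.toLp 2 (Fin d → ℝ)).symm.measurableEmbedding]
  refine integral_congr_ae (.of_forall fun v ↦ ?_)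
  simp only [smul_eq_mul, EuclideanSpace.inner_eq_star_dotProduct, star_trivial]
  congr 2
  push_cast
  ring

/-- Plancherel's theorem in the coordinates of `Fin d → ℝ`. -/
theorem lintegral_enorm_sq_integral_cexp_dotProduct {f : (Fin d → ℝ) → ℂ} (hf : Integrable f)
    (hf2 : MemLp f 2) :
    ∫⁻ ω : Fin d → ℝ, ‖∫ y : Fin d → ℝ,
      Complex.exp (-2 * (Real.pi : ℂ) * Complex.I * ((ω ⬝ᵥ y : ℝ) : ℂ)) * f y‖ₑ ^ 2 =
      ∫⁻ y, ‖f y‖ₑ ^ 2 := by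
  have hp := PiLp.volume_preserving_ofLp (Fin d)
  have he : MeasurableEmbedding (WithLp.ofLp : EuclideanSpace ℝ (Fin d) → Fin d → ℝ) :=
    (MeasurableEquiv.toLp 2 (Fin d → ℝ)).symm.measurableEmbedding
  simp_rw [integral_cexp_dotProduct_eq_fourier]
  rw [← hp.lintegral_comp_emb he, ← hp.lintegral_comp_emb he]
  exact lintegral_enorm_sq_fourier ((hp.integrable_comp_emb he).2 hf)
    (hf2.comp_measurePreserving hp)

/-- Fourier inversion for conjugates of Schwartz functions. -/
theorem integral_cexp_dotProduct_conj_fourier (ψ : 𝓢(EuclideanSpace ℝ (Fin d), ℂ))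
    (ω : Fin d → ℝ) :
    ∫ y : Fin d → ℝ, Complex.exp (-2 * (Real.pi : ℂ) * Complex.I * ((ω ⬝ᵥ y : ℝ) : ℂ)) *
      conj (𝓕 ψ (WithLp.toLp 2 y)) = conj (ψ (WithLp.toLp 2 ω)) := by
  have h : 𝓕⁻ (𝓕 ψ) (WithLp.toLp 2 ω) = ψ (WithLp.toLp 2 ω) := by
    rw [FourierTransform.fourierInv_fourier_eq]
  rw [integral_cexp_dotProduct_eq_fourier, Real.fourier_eq', ← h, SchwartzMap.fourierInv_coe,
    Real.fourierInv_eq', ← integral_conj]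
  refine integral_congr_ae (.of_forall fun v ↦ ?_)
  simp only [smul_eq_mul, map_mul, ← Complex.exp_conj, Complex.conj_ofReal, Complex.conj_I]
  congr 2
  push_cast
  ring

end Coordinates

section HilbertGraph

variable {H : Type*} [NormedAddCommGroup H] [InnerProductSpace ℂ H]

theorem inner_eq_of_norm_eq_on_submodule {Γ : Submodule ℂ (H × H)}
    (hΓ : ∀ p ∈ Γ, ‖p.1‖ = ‖p.2‖) {p q : H × H} (hp : p ∈ Γ) (hq : q ∈ Γ) :
    inner ℂ p.1 q.1 = inner ℂ p.2 q.2 := by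
  rw [inner_eq_sum_norm_sq_div_four, inner_eq_sum_norm_sq_div_four]
  have h1 := hΓ _ (Γ.add_mem hp hq)
  have h2 := hΓ _ (Γ.sub_mem hp hq)
  have h3 := hΓ _ (Γ.add_mem hp (Γ.smul_mem Complex.I hq))
  have h4 := hΓ _ (Γ.sub_mem hp (Γ.smul_mem Complex.I hq))
  simp only [Prod.fst_add, Prod.snd_add, Prod.fst_sub, Prod.snd_sub, Prod.smul_fst,
    Prod.smul_snd] at h1 h2 h3 h4
  simp only [RCLike.I_to_complex, h1, h2, h3, h4]

/-- A norm-preserving linear relation maps orthonormal families to orthonormal families. -/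
theorem Orthonormal.of_norm_preserving_relation {ι : Type*} {Γ : Submodule ℂ (H × H)}
    (hΓ : ∀ p ∈ Γ, ‖p.1‖ = ‖p.2‖) {e f : ι → H} (hef : ∀ i, (e i, f i) ∈ Γ)
    (he : Orthonormal ℂ e) : Orthonormal ℂ f := by
  refine ⟨fun i ↦ (hΓ _ (hef i)).symm.trans (he.1 i), fun i j hij ↦ ?_⟩
  exact (inner_eq_of_norm_eq_on_submodule hΓ (hef i) (hef j)).symm.trans (he.2 hij)

/-- If a family with dense span is mapped to the family `f` by a norm-preserving linear relation,
then the range of the relation is contained in the closed span of `f`. -/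
theorem mem_closure_span_of_norm_preserving_relation {ι : Type*} {Γ : Submodule ℂ (H × H)}
    (hΓ : ∀ p ∈ Γ, ‖p.1‖ = ‖p.2‖) {e f : ι → H} (hef : ∀ i, (e i, f i) ∈ Γ)
    (he : (Submodule.span ℂ (Set.range e)).topologicalClosure = ⊤) {p : H × H} (hp : p ∈ Γ) :
    p.2 ∈ (Submodule.span ℂ (Set.range f)).topologicalClosure := by
  have hspan : ∀ x ∈ Submodule.span ℂ (Set.range e),
      ∃ y ∈ Submodule.span ℂ (Set.range f), (x, y) ∈ Γ := by
    intro x hx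
    induction hx using Submodule.span_induction with
    | mem x hx =>
      obtain ⟨i, rfl⟩ := hx
      exact ⟨f i, Submodule.subset_span ⟨i, rfl⟩, hef i⟩
    | zero => exact ⟨0, zero_mem _, Γ.zero_mem⟩
    | add x y _ _ hx hy =>
      obtain ⟨x', hx', hxΓ⟩ := hx
      obtain ⟨y', hy', hyΓ⟩ := hy
      exact ⟨x' + y', add_mem hx' hy', Γ.add_mem hxΓ hyΓ⟩
    | smul c x _ hx =>
      obtain ⟨x', hx', hxΓ⟩ := hx
      exact ⟨c • x', Submodule.smul_mem _ c hx', Γ.smul_mem c hxΓ⟩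
  have h1 : p.1 ∈ closure (Submodule.span ℂ (Set.range e) : Set H) := by
    rw [← Submodule.topologicalClosure_coe, he]
    trivial
  rw [← SetLike.mem_coe, Submodule.topologicalClosure_coe, Metric.mem_closure_iff]
  intro ε hε
  obtain ⟨x, hx, hxε⟩ := Metric.mem_closure_iff.1 h1 ε hε
  obtain ⟨y, hy, hxy⟩ := hspan x hx
  refine ⟨y, hy, ?_⟩
  rw [dist_eq_norm] at hxε ⊢
  exact (hΓ _ (Γ.sub_mem hp hxy)).symm.trans_lt hxε

end HilbertGraph

section Tensor

variable {α β : Type*} [MeasureSpace α] [MeasureSpace β]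

theorem ae_fst_of_ae {p : α → Prop} (h : ∀ᵐ x, p x) : ∀ᵐ z : α × β, p z.1 :=
  Measure.quasiMeasurePreserving_fst.ae h

theorem ae_snd_of_ae {p : β → Prop} (h : ∀ᵐ x, p x) : ∀ᵐ z : α × β, p z.2 :=
  Measure.quasiMeasurePreserving_snd.ae h

variable [SigmaFinite (volume : Measure β)]

theorem eLpNorm_mul_conj_prod {f : α → ℂ} {g : β → ℂ} (hf : AEStronglyMeasurable f)
    (hg : AEStronglyMeasurable g) :
    eLpNorm (fun z : α × β ↦ f z.1 * conj (g z.2)) 2 volume =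
      eLpNorm f 2 volume * eLpNorm g 2 volume := by
  refine (ENNReal.pow_right_strictMono (n := 2) two_ne_zero).injective ?_
  simp only [mul_pow, ← lintegral_enorm_sq_eq_eLpNorm_sq, enorm_mul, RCLike.enorm_conj]
  exact lintegral_prod_mul (hf.enorm.pow_const 2) (hg.enorm.pow_const 2)

theorem memLp_mul_conj_prod {f : α → ℂ} {g : β → ℂ} (hf : MemLp f 2) (hg : MemLp g 2) :
    MemLp (fun z : α × β ↦ f z.1 * conj (g z.2)) 2 := by
  refine ⟨?_, ?_⟩
  · exact hf.1.comp_fst.mul (RCLike.continuous_conj.comp_aestronglyMeasurable hg.1.comp_snd)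
  · rw [eLpNorm_mul_conj_prod hf.1 hg.1]
    exact ENNReal.mul_lt_top hf.2 hg.2

/-- The tensor product `f ⊗ conj g` in `L²` of the product space. -/
noncomputable def tensorConj (f : Lp ℂ 2 (volume : Measure α)) (g : Lp ℂ 2 (volume : Measure β)) :
    Lp ℂ 2 (volume : Measure (α × β)) :=
  (memLp_mul_conj_prod (Lp.memLp f) (Lp.memLp g)).toLp _

theorem coeFn_tensorConj (f : Lp ℂ 2 (volume : Measure α)) (g : Lp ℂ 2 (volume : Measure β)) :
    tensorConj f g =ᵐ[volume] fun z ↦ f z.1 * conj (g z.2) :=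
  MemLp.coeFn_toLp _

theorem norm_tensorConj (f : Lp ℂ 2 (volume : Measure α)) (g : Lp ℂ 2 (volume : Measure β)) :
    ‖tensorConj f g‖ = ‖f‖ * ‖g‖ := by
  rw [tensorConj, Lp.norm_toLp, eLpNorm_mul_conj_prod (Lp.aestronglyMeasurable f)
    (Lp.aestronglyMeasurable g), ENNReal.toReal_mul, ← Lp.norm_def, ← Lp.norm_def]

/-- The map `f ↦ f ⊗ conj g` as a continuous linear map. -/
noncomputable def tensorConjLeft (g : Lp ℂ 2 (volume : Measure β)) :
    Lp ℂ 2 (volume : Measure α) →L[ℂ] Lp ℂ 2 (volume : Measure (α × β)) :=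
  LinearMap.mkContinuous
    { toFun := fun f ↦ tensorConj f g
      map_add' := fun f f' ↦ by
        refine Lp.ext ?_
        filter_upwards [Lp.coeFn_add (tensorConj f g) (tensorConj f' g), coeFn_tensorConj f g,
          coeFn_tensorConj f' g, coeFn_tensorConj (f + f') g,
          ae_fst_of_ae (β := β) (Lp.coeFn_add f f')] with z h1 h2 h3 h4 h5
        rw [h1, h4, h5, Pi.add_apply, Pi.add_apply, h2, h3, add_mul]
      map_smul' := fun a f ↦ by
        refine Lp.ext ?_
        filter_upwards [Lp.coeFn_smul a (tensorConj f g), coeFn_tensorConj f g,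
          coeFn_tensorConj (a • f) g, ae_fst_of_ae (β := β) (Lp.coeFn_smul a f)]
          with z h1 h2 h3 h4
        rw [RingHom.id_apply, h1, h3, h4, Pi.smul_apply, Pi.smul_apply, h2, smul_mul_assoc] }
    ‖g‖ fun f ↦ (norm_tensorConj f g).trans_le (mul_comm _ _).le

theorem tensorConj_sub_right (f : Lp ℂ 2 (volume : Measure α))
    (g g' : Lp ℂ 2 (volume : Measure β)) :
    tensorConj f g - tensorConj f g' = tensorConj f (g - g') := by
  refine Lp.ext ?_
  filter_upwards [Lp.coeFn_sub (tensorConj f g) (tensorConj f g'), coeFn_tensorConj f g,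
    coeFn_tensorConj f g', coeFn_tensorConj f (g - g'),
    ae_snd_of_ae (α := α) (Lp.coeFn_sub g g')] with z h1 h2 h3 h4 h5
  rw [h1, h4, h5, Pi.sub_apply, Pi.sub_apply, h2, h3, map_sub, mul_sub]

theorem continuous_tensorConj_right (f : Lp ℂ 2 (volume : Measure α)) :
    Continuous fun g : Lp ℂ 2 (volume : Measure β) ↦ tensorConj f g :=
  (LipschitzWith.of_dist_le_mul (K := ‖f‖₊) fun g g' ↦ by
    rw [dist_eq_norm, dist_eq_norm, tensorConj_sub_right, norm_tensorConj]
    rfl).continuous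

variable [SigmaFinite (volume : Measure α)]

theorem ae_memLp_two_prod_right {G : α × β → ℂ} (hG : MemLp G 2) :
    ∀ᵐ x : α, MemLp (fun y ↦ G (x, y)) 2 := by
  have h : Integrable (fun z : α × β ↦ ‖G z‖ ^ 2) (volume.prod volume) :=
    hG.integrable_norm_pow two_ne_zero
  filter_upwards [h.prod_right_ae, hG.1.prodMk_left] with x hx hx'
  exact (memLp_two_iff_integrable_sq_norm hx').2 hx

theorem inner_tensorConj (f f' : Lp ℂ 2 (volume : Measure α))
    (g g' : Lp ℂ 2 (volume : Measure β)) :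
    inner ℂ (tensorConj f g) (tensorConj f' g') = inner ℂ f f' * inner ℂ g' g := by
  rw [L2.inner_def, L2.inner_def, L2.inner_def]
  simp only [RCLike.inner_apply]
  rw [← integral_prod_mul]
  refine integral_congr_ae ?_
  filter_upwards [coeFn_tensorConj f g, coeFn_tensorConj f' g'] with z h1 h2
  rw [h1, h2, map_mul, Complex.conj_conj]
  ring

theorem orthonormal_tensorConj {ι κ : Type*} {e : ι → Lp ℂ 2 (volume : Measure α)}
    {e' : κ → Lp ℂ 2 (volume : Measure β)} (he : Orthonormal ℂ e) (he' : Orthonormal ℂ e') :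
    Orthonormal ℂ fun p : ι × κ ↦ tensorConj (e p.1) (e' p.2) := by
  classical
  rw [orthonormal_iff_ite] at he he' ⊢
  rintro ⟨i, j⟩ ⟨i', j'⟩
  rw [inner_tensorConj, he, he']
  by_cases h1 : i = i' <;> by_cases h2 : j = j' <;> simp [h1, h2, Ne.symm]

/-- If `G ∈ L²` is orthogonal to all `f ⊗ conj (b n)` for a Hilbert basis `b`, then `G = 0`. -/
theorem eq_zero_of_inner_tensorConj_eq_zero {κ : Type*} [Countable κ]
    (b : HilbertBasis κ ℂ (Lp ℂ 2 (volume : Measure β)))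
    {G : Lp ℂ 2 (volume : Measure (α × β))}
    (hG : ∀ (f : Lp ℂ 2 (volume : Measure α)) (n : κ), inner ℂ (tensorConj f (b n)) G = 0) :
    G = 0 := by
  have hprod (n : κ) {s : Set α} (hs : MeasurableSet s) (hμs : volume s < ∞) :
      Integrable (fun z : α × β ↦ s.indicator 1 z.1 * (G z * b n z.2)) := by
    have h1 := memLp_mul_conj_prod (memLp_indicator_const 2 hs (1 : ℂ) (Or.inr hμs.ne))
      (Lp.memLp (b n))
    have h1' : MemLp (fun z : α × β ↦ s.indicator 1 z.1 * b n z.2) 2 := by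
      refine h1.of_le ?_ (.of_forall fun z ↦ ?_)
      · exact ((aestronglyMeasurable_const (b := (1 : ℂ))).indicator hs).comp_fst.mul
          (Lp.aestronglyMeasurable (b n)).comp_snd
      · simp only [norm_mul, RCLike.norm_conj]
        rfl
    refine (h1'.integrable_mul (Lp.memLp G)).congr (.of_forall fun z ↦ ?_)
    simp only [Pi.mul_apply]
    ring
  have hzero (n : κ) : ∀ᵐ x : α, ∫ y, G (x, y) * b n y = 0 := by
    have hslice {s : Set α} (x : α) :
        ∫ y, s.indicator 1 x * (G (x, y) * b n y) =
          s.indicator (fun x ↦ ∫ y, G (x, y) * b n y) x := by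
      by_cases hx : x ∈ s <;> simp [hx]
    refine ae_eq_zero_of_forall_setIntegral_eq_of_sigmaFinite (fun s hs hμs ↦ ?_)
      fun s hs hμs ↦ ?_
    · have := (hprod n hs hμs).integral_prod_left
      simp only [hslice] at this
      exact (integrable_indicator_iff hs).1 this
    · rw [← integral_indicator hs]
      simp only [← hslice]
      rw [← integral_prod _ (hprod n hs hμs),
        ← hG (indicatorConstLp 2 hs hμs.ne (1 : ℂ)) n, L2.inner_def]
      refine integral_congr_ae ?_
      filter_upwards [coeFn_tensorConj (indicatorConstLp 2 hs hμs.ne (1 : ℂ)) (b n),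
        ae_fst_of_ae (β := β) (indicatorConstLp_coeFn (p := 2) (hs := hs) (hμs := hμs.ne)
          (c := (1 : ℂ)))] with z h1 h2
      rw [RCLike.inner_apply, h1, h2, map_mul, Complex.conj_conj]
      by_cases hz : z.1 ∈ s <;> simp [hz]
  have hae : ∀ᵐ x : α, ∀ᵐ y : β, G (x, y) = 0 := by
    filter_upwards [ae_memLp_two_prod_right (Lp.memLp G), ae_all_iff.2 hzero] with x hx hx0
    have hconj : MemLp (fun y ↦ conj (G (x, y))) 2 := hx.star
    have : hconj.toLp _ = 0 := by
      have hb : b.repr (hconj.toLp _) = 0 := by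
        ext n
        rw [HilbertBasis.repr_apply_apply, L2.inner_def, lp.coeFn_zero, Pi.zero_apply,
          ← RingHom.map_zero (starRingEnd ℂ), ← hx0 n, ← integral_conj]
        refine integral_congr_ae ?_
        filter_upwards [hconj.coeFn_toLp] with y hy
        rw [RCLike.inner_apply, hy, map_mul]
      simpa using hb
    filter_upwards [hconj.coeFn_toLp, (Lp.eq_zero_iff_ae_eq_zero).1 this] with y h1 h2
    simpa [h1] using h2
  refine Lp.ext ?_
  have h := (Measure.ae_prod_iff_ae_ae (μ := (volume : Measure α)) (ν := (volume : Measure β))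
    (p := fun z ↦ G z = 0)
    ((Lp.stronglyMeasurable G).measurable (measurableSet_singleton 0))).2 hae
  filter_upwards [h, Lp.coeFn_zero ℂ 2 (volume : Measure (α × β))] with z h1 h2
  rw [h2]
  exact h1

theorem topologicalClosure_span_tensorConj_eq_top {ι κ : Type*} [Countable κ]
    (b : HilbertBasis ι ℂ (Lp ℂ 2 (volume : Measure α)))
    (b' : HilbertBasis κ ℂ (Lp ℂ 2 (volume : Measure β))) :
    (Submodule.span ℂ (Set.range fun p : ι × κ ↦
      tensorConj (b p.1) (b' p.2))).topologicalClosure = ⊤ := by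
  rw [Submodule.topologicalClosure_eq_top_iff, Submodule.eq_bot_iff]
  intro G hG
  refine eq_zero_of_inner_tensorConj_eq_zero b' fun f n ↦ ?_
  have hle : (Submodule.span ℂ (Set.range b)).topologicalClosure ≤
      (ℂ ∙ G)ᗮ.comap (tensorConjLeft (b' n)).toLinearMap := by
    refine Submodule.topologicalClosure_minimal _ (Submodule.span_le.2 ?_)
      ((Submodule.isClosed_orthogonal _).preimage (tensorConjLeft (b' n)).continuous)
    rintro _ ⟨m, rfl⟩
    exact Submodule.mem_orthogonal_singleton_iff_inner_left.2
      (hG _ (Submodule.subset_span ⟨(m, n), rfl⟩))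
  exact Submodule.mem_orthogonal_singleton_iff_inner_left.1
    (hle (b.dense_span.symm ▸ Submodule.mem_top))

end Tensor

section WignerRelation

variable {d : ℕ}

theorem ae_comp_linearEquiv {E : Type*} [NormedAddCommGroup E] [NormedSpace ℝ E]
    [FiniteDimensional ℝ E] [MeasurableSpace E] [BorelSpace E] (μ : Measure E)
    [μ.IsAddHaarMeasure] (L : E ≃ₗ[ℝ] E) {p : E → Prop} (h : ∀ᵐ z ∂μ, p z) :
    ∀ᵐ z ∂μ, p (L z) :=
  (Measure.LinearMap.quasiMeasurePreserving μ (L : E →ₗ[ℝ] E) L.isUnit_det'.ne_zero).ae h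

theorem map_linearEquiv_eq_smul {E : Type*} [NormedAddCommGroup E] [NormedSpace ℝ E]
    [FiniteDimensional ℝ E] [MeasurableSpace E] [BorelSpace E] (μ : Measure E)
    [μ.IsAddHaarMeasure] (L : E ≃ₗ[ℝ] E) :
    μ.map L = ENNReal.ofReal |(LinearMap.det (L : E →ₗ[ℝ] E))⁻¹| • μ :=
  Measure.map_linearMap_addHaar_eq_smul_addHaar μ L.isUnit_det'.ne_zero

theorem MeasureTheory.MemLp.comp_linearEquiv {E : Type*} [NormedAddCommGroup E] [NormedSpace ℝ E]
    [FiniteDimensional ℝ E] [MeasurableSpace E] [BorelSpace E] {μ : Measure E}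
    [μ.IsAddHaarMeasure] {f : E → ℂ} {p : ℝ≥0∞} (hf : MemLp f p μ) (L : E ≃ₗ[ℝ] E) :
    MemLp (fun z ↦ f (L z)) p μ := by
  refine MemLp.comp_of_map (g := f) ?_
    (L : E →ₗ[ℝ] E).continuous_of_finiteDimensional.measurable.aemeasurable
  exact (map_linearEquiv_eq_smul μ L) ▸ hf.smul_measure ENNReal.ofReal_ne_top

instance isAddHaarMeasure_volume_prod :
    (volume : Measure ((Fin d → ℝ) × (Fin d → ℝ))).IsAddHaarMeasure :=
  Measure.prod.instIsAddHaarMeasure (volume : Measure (Fin d → ℝ)) (volume : Measure (Fin d → ℝ))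

/-- The graph of the unitary operator that composes with `L`, rescales, and applies the Fourier
transform in the second variable, restricted to those functions for which the Fourier integral
converges. -/
def wignerRelation (c : ℂ) (L : ((Fin d → ℝ) × (Fin d → ℝ)) ≃ₗ[ℝ] ((Fin d → ℝ) × (Fin d → ℝ))) :
    Submodule ℂ (Lp ℂ 2 (volume : Measure ((Fin d → ℝ) × (Fin d → ℝ))) ×
      Lp ℂ 2 (volume : Measure ((Fin d → ℝ) × (Fin d → ℝ)))) where
  carrier := {p | (∀ᵐ x : Fin d → ℝ, Integrable fun y : Fin d → ℝ ↦ p.1 (L (x, y))) ∧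
    p.2 =ᵐ[volume] fun z ↦ c * ∫ y : Fin d → ℝ,
      Complex.exp (-2 * (Real.pi : ℂ) * Complex.I * ((z.2 ⬝ᵥ y : ℝ) : ℂ)) * p.1 (L (z.1, y))}
  zero_mem' := by
    have h0 := Measure.ae_ae_of_ae_prod (ae_comp_linearEquiv volume L
      (Lp.coeFn_zero ℂ 2 (volume : Measure ((Fin d → ℝ) × (Fin d → ℝ)))))
    refine ⟨?_, ?_⟩
    · filter_upwards [h0] with x hx
      exact (integrable_zero _ _ _).congr (hx.mono fun y hy ↦ hy.symm)
    · filter_upwards [Lp.coeFn_zero ℂ 2 (volume : Measure ((Fin d → ℝ) × (Fin d → ℝ))),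
        ae_fst_of_ae (β := Fin d → ℝ) h0] with z h1 h2
      rw [Prod.snd_zero, h1, integral_eq_zero_of_ae, mul_zero, Pi.zero_apply]
      filter_upwards [h2] with y hy
      rw [Prod.fst_zero, hy, Pi.zero_apply, mul_zero, Pi.zero_apply]
  add_mem' := by
    rintro p q ⟨hp1, hp2⟩ ⟨hq1, hq2⟩
    have hadd := Measure.ae_ae_of_ae_prod (ae_comp_linearEquiv volume L
      (Lp.coeFn_add p.1 q.1))
    refine ⟨?_, ?_⟩
    · filter_upwards [hadd, hp1, hq1] with x hx h1 h2
      exact (h1.add h2).congr (hx.mono fun y hy ↦ hy.symm)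
    · filter_upwards [Lp.coeFn_add p.2 q.2, hp2, hq2, ae_fst_of_ae (β := Fin d → ℝ) hadd,
        ae_fst_of_ae (β := Fin d → ℝ) hp1, ae_fst_of_ae (β := Fin d → ℝ) hq1]
        with z h1 h2 h3 h4 h5 h6
      rw [Prod.snd_add, h1, Pi.add_apply, h2, h3, ← mul_add,
        ← integral_add (integrable_cexp_dotProduct_mul h5 z.2)
          (integrable_cexp_dotProduct_mul h6 z.2)]
      congr 1
      refine integral_congr_ae ?_
      filter_upwards [h4] with y hy
      rw [Prod.fst_add, hy, Pi.add_apply, mul_add]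
  smul_mem' := by
    rintro a p ⟨hp1, hp2⟩
    have hsmul := Measure.ae_ae_of_ae_prod (ae_comp_linearEquiv volume L
      (Lp.coeFn_smul a p.1))
    refine ⟨?_, ?_⟩
    · filter_upwards [hsmul, hp1] with x hx h1
      exact (h1.smul a).congr (hx.mono fun y hy ↦ hy.symm)
    · filter_upwards [Lp.coeFn_smul a p.2, hp2, ae_fst_of_ae (β := Fin d → ℝ) hsmul]
        with z h1 h2 h3
      rw [Prod.smul_snd, h1, Pi.smul_apply, h2, smul_eq_mul, mul_left_comm,
        ← integral_const_mul]
      congr 1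
      refine integral_congr_ae ?_
      filter_upwards [h3] with y hy
      rw [Prod.smul_fst, hy, Pi.smul_apply, smul_eq_mul, mul_left_comm]

variable {L : ((Fin d → ℝ) × (Fin d → ℝ)) ≃ₗ[ℝ] ((Fin d → ℝ) × (Fin d → ℝ))}

theorem norm_eq_of_mem_wignerRelation {c : ℂ}
    (hc : ‖c‖ ^ 2 = |LinearMap.det (L : (Fin d → ℝ) × (Fin d → ℝ) →ₗ[ℝ] _)|)
    {p : Lp ℂ 2 (volume : Measure ((Fin d → ℝ) × (Fin d → ℝ))) ×
      Lp ℂ 2 (volume : Measure ((Fin d → ℝ) × (Fin d → ℝ)))} (hp : p ∈ wignerRelation c L) :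
    ‖p.1‖ = ‖p.2‖ := by
  obtain ⟨h1, h2⟩ := hp
  have hmeas (f : Lp ℂ 2 (volume : Measure ((Fin d → ℝ) × (Fin d → ℝ)))) :
      Measurable fun z ↦ ‖f z‖ₑ ^ 2 :=
    (Lp.stronglyMeasurable f).measurable.enorm.pow_const 2
  have hLm : Measurable L :=
    L.toLinearMap.continuous_of_finiteDimensional.measurable
  have hdet : LinearMap.det (L : (Fin d → ℝ) × (Fin d → ℝ) →ₗ[ℝ] _) ≠ 0 := L.isUnit_det'.ne_zero
  have hslice : ∀ᵐ x : Fin d → ℝ, ∫⁻ ω : Fin d → ℝ, ‖p.2 (x, ω)‖ₑ ^ 2 =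
      ‖c‖ₑ ^ 2 * ∫⁻ y : Fin d → ℝ, ‖p.1 (L (x, y))‖ₑ ^ 2 := by
    filter_upwards [h1, Measure.ae_ae_of_ae_prod h2,
      ae_memLp_two_prod_right ((Lp.memLp p.1).comp_linearEquiv L)] with x hx1 hx2 hx3
    rw [← lintegral_enorm_sq_integral_cexp_dotProduct hx1 hx3,
      ← lintegral_const_mul' _ _ (by simp)]
    refine lintegral_congr_ae ?_
    filter_upwards [hx2] with ω hω
    rw [hω, enorm_mul, mul_pow]
  have hsq : ∫⁻ z, ‖p.2 z‖ₑ ^ 2 = ∫⁻ z, ‖p.1 z‖ₑ ^ 2 := by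
    have h3 : ∫⁻ z, ‖p.1 (L z)‖ₑ ^ 2 = ∫⁻ x : Fin d → ℝ, ∫⁻ y : Fin d → ℝ, ‖p.1 (L (x, y))‖ₑ ^ 2 :=
      lintegral_prod _ ((hmeas p.1).comp hLm).aemeasurable
    refine (lintegral_prod _ (hmeas p.2).aemeasurable).trans ?_
    rw [lintegral_congr_ae hslice, lintegral_const_mul' _ _ (by simp), ← h3,
      ← lintegral_map (hmeas p.1) hLm, map_linearEquiv_eq_smul, lintegral_smul_measure,
      smul_eq_mul, ← mul_assoc, ← ofReal_norm, ← ENNReal.ofReal_pow (norm_nonneg _), hc,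
      ← ENNReal.ofReal_mul (abs_nonneg _), abs_inv, mul_inv_cancel₀ (abs_ne_zero.2 hdet),
      ENNReal.ofReal_one, one_mul]
  rw [lintegral_enorm_sq_eq_eLpNorm_sq, lintegral_enorm_sq_eq_eLpNorm_sq] at hsq
  rw [Lp.norm_def, Lp.norm_def,
    (ENNReal.pow_right_strictMono (n := 2) two_ne_zero).injective hsq]

theorem exists_mem_wignerRelation_tensorConj {c : ℂ} (hc : c ≠ 0)
    (f : Lp ℂ 2 (volume : Measure (Fin d → ℝ))) (ψ : 𝓢(EuclideanSpace ℝ (Fin d), ℂ)) :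
    ∃ h, (h, tensorConj f (Lp.compMeasurePreserving _ (PiLp.volume_preserving_toLp (Fin d))
      (ψ.toLp 2))) ∈ wignerRelation c L := by
  have hp := PiLp.volume_preserving_toLp (Fin d)
  have hψ : MemLp (fun y : Fin d → ℝ ↦ 𝓕 ψ (WithLp.toLp 2 y)) 2 :=
    ((𝓕 ψ).memLp 2).comp_measurePreserving hp
  have hψ1 : Integrable (fun y : Fin d → ℝ ↦ 𝓕 ψ (WithLp.toLp 2 y)) :=
    (hp.integrable_comp_emb (MeasurableEquiv.toLp 2 (Fin d → ℝ)).measurableEmbedding).2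
      (𝓕 ψ).integrable
  have hmem := ((memLp_mul_conj_prod (Lp.memLp f) hψ).const_mul c⁻¹).comp_linearEquiv L.symm
  have hae : ∀ᵐ z : (Fin d → ℝ) × (Fin d → ℝ), hmem.toLp _ (L z) =
      c⁻¹ * (f z.1 * conj (𝓕 ψ (WithLp.toLp 2 z.2))) := by
    filter_upwards [ae_comp_linearEquiv volume L hmem.coeFn_toLp] with z hz
    rw [hz, L.symm_apply_apply]
  have hae' := Measure.ae_ae_of_ae_prod hae
  refine ⟨hmem.toLp _, ?_, ?_⟩
  · filter_upwards [hae'] with x hx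
    refine Integrable.congr ?_ (hx.mono fun y hy ↦ hy.symm)
    exact ((RCLike.conjCLE.toContinuousLinearMap.integrable_comp hψ1).const_mul _).const_mul _
  · filter_upwards [ae_fst_of_ae (β := Fin d → ℝ) hae', coeFn_tensorConj f _,
      ae_snd_of_ae (α := Fin d → ℝ) (Lp.coeFn_compMeasurePreserving (ψ.toLp 2) hp),
      ae_snd_of_ae (α := Fin d → ℝ) (hp.quasiMeasurePreserving.ae (ψ.coeFn_toLp 2 volume))]
      with z h1 h2 h3 h4
    rw [h2, h3, Function.comp_apply, h4, ← integral_cexp_dotProduct_conj_fourier,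
      ← integral_const_mul, ← integral_const_mul]
    refine integral_congr_ae ?_
    filter_upwards [h1] with y hy
    rw [hy]
    field_simp

end WignerRelation

section BlockMatrix

variable {d : ℕ} (A₁₁ A₁₂ A₂₁ A₂₂ : Matrix (Fin d) (Fin d) ℝ)

/-- The linear map `(x, y) ↦ (A₁₁ x + A₁₂ y, A₂₁ x + A₂₂ y)` on pairs of vectors. -/
noncomputable def blockLinearMap : (Fin d → ℝ) × (Fin d → ℝ) →ₗ[ℝ] (Fin d → ℝ) × (Fin d → ℝ) :=
  (LinearEquiv.sumArrowLequivProdArrow (Fin d) (Fin d) ℝ ℝ).toLinearMap ∘ₗ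
    Matrix.toLin' (Matrix.fromBlocks A₁₁ A₁₂ A₂₁ A₂₂) ∘ₗ
      (LinearEquiv.sumArrowLequivProdArrow (Fin d) (Fin d) ℝ ℝ).symm.toLinearMap

theorem det_blockLinearMap : LinearMap.det (blockLinearMap A₁₁ A₁₂ A₂₁ A₂₂) =
    (Matrix.fromBlocks A₁₁ A₁₂ A₂₁ A₂₂).det := by
  rw [blockLinearMap, LinearMap.det_conj, LinearMap.det_toLin']

theorem blockLinearMap_apply (x y : Fin d → ℝ) : blockLinearMap A₁₁ A₁₂ A₂₁ A₂₂ (x, y) =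
    (A₁₁.mulVec x + A₁₂.mulVec y, A₂₁.mulVec x + A₂₂.mulVec y) := by
  have h : (LinearEquiv.sumArrowLequivProdArrow (Fin d) (Fin d) ℝ ℝ).symm (x, y) =
      Sum.elim x y := by
    ext (i | i) <;> rfl
  ext i <;> simp [blockLinearMap, h, Matrix.fromBlocks_mulVec]

end BlockMatrix

theorem MeasureTheory.MemLp.comp_mulVec_add {d : ℕ} {f : (Fin d → ℝ) → ℂ} (hf : MemLp f 2)
    {M : Matrix (Fin d) (Fin d) ℝ} (hM : M.det ≠ 0) (v : Fin d → ℝ) :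
    MemLp (fun y ↦ f (v + M.mulVec y)) 2 := by
  have hdet : LinearMap.det (Matrix.toLin' M) ≠ 0 := by rwa [LinearMap.det_toLin']
  exact (hf.comp_measurePreserving (measurePreserving_add_left volume v)).comp_linearEquiv
    (LinearMap.equivOfDetNeZero (Matrix.toLin' M) hdet)

theorem tensorConj_mem_wignerRelation {d : ℕ} {A₁₁ A₁₂ A₂₁ A₂₂ : Matrix (Fin d) (Fin d) ℝ}
    (h12 : A₁₂.det ≠ 0) (h22 : A₂₂.det ≠ 0)
    {L : ((Fin d → ℝ) × (Fin d → ℝ)) ≃ₗ[ℝ] ((Fin d → ℝ) × (Fin d → ℝ))}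
    (hL : ∀ x y, L (x, y) =
      (A₁₁.mulVec x + A₁₂.mulVec y, A₂₁.mulVec x + A₂₂.mulVec y))
    {c : ℂ} (f g : Lp ℂ 2 (volume : Measure (Fin d → ℝ)))
    {k : Lp ℂ 2 (volume : Measure ((Fin d → ℝ) × (Fin d → ℝ)))}
    (hk : k =ᵐ[volume] fun z ↦ c * mwd A₁₁ A₁₂ A₂₁ A₂₂ f g z.1 z.2) :
    (tensorConj f g, k) ∈ wignerRelation c L := by
  have hae := Measure.ae_ae_of_ae_prod (ae_comp_linearEquiv volume L (coeFn_tensorConj f g))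
  simp only [hL] at hae
  refine ⟨?_, ?_⟩
  · filter_upwards [hae] with x hx
    simp only [hL]
    refine Integrable.congr ?_ (hx.mono fun y hy ↦ hy.symm)
    exact ((Lp.memLp f).comp_mulVec_add h12 _).integrable_mul
      ((Lp.memLp g).comp_mulVec_add h22 _).star
  · filter_upwards [hk, ae_fst_of_ae (β := Fin d → ℝ) hae] with z h1 h2
    rw [h1, mwd]
    congr 1
    refine integral_congr_ae ?_
    filter_upwards [h2] with y hy
    rw [hL, hy, mul_assoc]

/-- If `(e_n)` is a Hilbert basis of `L²(ℝ^d)` and `A` is invertible and right-regular, then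
the family `|det A|^{1/2} B_A(e_m, e_n)` is a Hilbert basis of `L²(ℝ^{2d})`:
it is orthonormal and its span is dense. -/
theorem mwd_hilbertBasis {d : ℕ} (A₁₁ A₁₂ A₂₁ A₂₂ : Matrix (Fin d) (Fin d) ℝ)
    (hA : (Matrix.fromBlocks A₁₁ A₁₂ A₂₁ A₂₂).det ≠ 0)
    (h12 : A₁₂.det ≠ 0) (h22 : A₂₂.det ≠ 0)
    (b : HilbertBasis ℕ ℂ (Lp ℂ 2 (volume : Measure (Fin d → ℝ))))
    (F : ℕ × ℕ → Lp ℂ 2 (volume : Measure ((Fin d → ℝ) × (Fin d → ℝ))))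
    (hF : ∀ m n : ℕ,
      (F (m, n) : ((Fin d → ℝ) × (Fin d → ℝ)) → ℂ) =ᵐ[volume]
        fun z => ((Real.sqrt |(Matrix.fromBlocks A₁₁ A₁₂ A₂₁ A₂₂).det| : ℝ) : ℂ) *
          mwd A₁₁ A₁₂ A₂₁ A₂₂ (⇑(b m)) (⇑(b n)) z.1 z.2) :
    Orthonormal ℂ F ∧ (Submodule.span ℂ (Set.range F)).topologicalClosure = ⊤ := by
  set D := (Matrix.fromBlocks A₁₁ A₁₂ A₂₁ A₂₂).det
  have hdet : LinearMap.det (blockLinearMap A₁₁ A₁₂ A₂₁ A₂₂) ≠ 0 := by rwa [det_blockLinearMap]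
  set L := LinearMap.equivOfDetNeZero _ hdet
  have hL (x y : Fin d → ℝ) : L (x, y) =
      (A₁₁.mulVec x + A₁₂.mulVec y, A₂₁.mulVec x + A₂₂.mulVec y) :=
    blockLinearMap_apply A₁₁ A₁₂ A₂₁ A₂₂ x y
  have hLdet : LinearMap.det (L : (Fin d → ℝ) × (Fin d → ℝ) →ₗ[ℝ] _) = D :=
    det_blockLinearMap A₁₁ A₁₂ A₂₁ A₂₂
  set c : ℂ := ((Real.sqrt |D| : ℝ) : ℂ) with hc
  have hc0 : c ≠ 0 := by
    rw [hc, Complex.ofReal_ne_zero]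
    exact (Real.sqrt_pos.2 (abs_pos.2 hA)).ne'
  have hcD : ‖c‖ ^ 2 = |LinearMap.det (L : (Fin d → ℝ) × (Fin d → ℝ) →ₗ[ℝ] _)| := by
    rw [hLdet, hc, Complex.norm_real, Real.norm_eq_abs, sq_abs, Real.sq_sqrt (abs_nonneg D)]
  have hΓ : ∀ p ∈ wignerRelation c L, ‖p.1‖ = ‖p.2‖ :=
    fun p hp ↦ norm_eq_of_mem_wignerRelation hcD hp
  have hmem (p : ℕ × ℕ) : (tensorConj (b p.1) (b p.2), F p) ∈ wignerRelation c L :=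
    tensorConj_mem_wignerRelation h12 h22 hL _ _ (hF p.1 p.2)
  refine ⟨(orthonormal_tensorConj b.orthonormal b.orthonormal).of_norm_preserving_relation hΓ hmem,
    ?_⟩
  have hdense := topologicalClosure_span_tensorConj_eq_top b b
  rw [← Submodule.orthogonal_eq_bot_iff, Submodule.eq_bot_iff]
  intro G hG
  refine eq_zero_of_inner_tensorConj_eq_zero b fun f n ↦ ?_
  have hp := PiLp.volume_preserving_toLp (Fin d)
  have hclosed : IsClosed {g : Lp ℂ 2 (volume : Measure (EuclideanSpace ℝ (Fin d))) |
      inner ℂ (tensorConj f (Lp.compMeasurePreserving _ hp g)) G = 0} :=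
    isClosed_eq ((((continuous_tensorConj_right f).comp
      (Lp.isometry_compMeasurePreserving hp).continuous)).inner continuous_const) continuous_const
  have hall (g : Lp ℂ 2 (volume : Measure (EuclideanSpace ℝ (Fin d)))) :
      inner ℂ (tensorConj f (Lp.compMeasurePreserving _ hp g)) G = 0 := by
    refine (SchwartzMap.denseRange_toLpCLM (p := 2) ENNReal.ofNat_ne_top).induction_on
      (p := fun g ↦ inner ℂ (tensorConj f (Lp.compMeasurePreserving _ hp g)) G = 0) g hclosed
      fun ψ ↦ ?_
    obtain ⟨h, hh⟩ := exists_mem_wignerRelation_tensorConj (L := L) hc0 f ψ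
    exact hG _ (mem_closure_span_of_norm_preserving_relation hΓ hmem hdense hh)
  have hq := PiLp.volume_preserving_ofLp (Fin d)
  have hbn : Lp.compMeasurePreserving _ hp (Lp.compMeasurePreserving _ hq (b n)) = b n := by
    refine Lp.ext ?_
    filter_upwards [Lp.coeFn_compMeasurePreserving (Lp.compMeasurePreserving _ hq (b n)) hp,
      hp.quasiMeasurePreserving.ae (Lp.coeFn_compMeasurePreserving (b n) hq)] with y h1 h2
    rw [h1, Function.comp_apply, h2, Function.comp_apply]
  rw [← hbn]
  exact hall _
end

section
/- (Pointwise inversion formula.) Let A be a real invertible (2d)×(2d) matrix, and write the inverse in d×d blocks A^{-1} = [[(A^{-1})₁₁, (A^{-1})₁₂], [(A^{-1})₂₁, (A^{-1})₂₂]]. Then for every Schwartz function f : ℝ^d → ℂ with f(0) ≠ 0 and every x ∈ ℝ^d, f(x) = (1/conj(f(0))) · ∫_{ℝ^d} e^{2πi ((A^{-1})₂₁x)·ω} · B_A(f,f)((A^{-1})₁₁x, ω) dω. -/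
open MeasureTheory Matrix ComplexConjugate
open scoped Real Matrix

/-- The tensor product `(x, y) ↦ f x * g y` of two Schwartz functions, as a Schwartz function. -/
noncomputable def SchwartzMap.tensorMul {E F : Type*} [NormedAddCommGroup E] [NormedSpace ℝ E]
    [NormedAddCommGroup F] [NormedSpace ℝ F] (f : SchwartzMap E ℂ) (g : SchwartzMap F ℂ) :
    SchwartzMap (E × F) ℂ where
  toFun p := f p.1 * g p.2
  smooth' := ((f.smooth ⊤).comp contDiff_fst).mul ((g.smooth ⊤).comp contDiff_snd)
  decay' k n := by
    refine ⟨∑ i ∈ Finset.range (n + 1), (n.choose i : ℝ) *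
      (SchwartzMap.seminorm ℝ k i f * SchwartzMap.seminorm ℝ 0 (n - i) g +
        SchwartzMap.seminorm ℝ 0 i f * SchwartzMap.seminorm ℝ k (n - i) g), fun p ↦ ?_⟩
    have hf (i : ℕ) : ‖iteratedFDeriv ℝ i (fun p : E × F ↦ f p.1) p‖ ≤
        ‖iteratedFDeriv ℝ i f p.1‖ := by
      have h := (ContinuousLinearMap.fst ℝ E F).iteratedFDeriv_comp_right (f.smooth ⊤) p
        (i := i) (mod_cast le_top)
      change ‖iteratedFDeriv ℝ i (f ∘ ContinuousLinearMap.fst ℝ E F) p‖ ≤ _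
      rw [h]
      refine (ContinuousMultilinearMap.norm_compContinuousLinearMap_le _ _).trans
        (mul_le_of_le_one_right (norm_nonneg _)
          (Finset.prod_le_one (fun _ _ ↦ norm_nonneg _) fun _ _ ↦ ?_))
      exact ContinuousLinearMap.norm_fst_le ℝ E F
    have hg (i : ℕ) : ‖iteratedFDeriv ℝ i (fun p : E × F ↦ g p.2) p‖ ≤
        ‖iteratedFDeriv ℝ i g p.2‖ := by
      have h := (ContinuousLinearMap.snd ℝ E F).iteratedFDeriv_comp_right (g.smooth ⊤) p
        (i := i) (mod_cast le_top)
      change ‖iteratedFDeriv ℝ i (g ∘ ContinuousLinearMap.snd ℝ E F) p‖ ≤ _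
      rw [h]
      refine (ContinuousMultilinearMap.norm_compContinuousLinearMap_le _ _).trans
        (mul_le_of_le_one_right (norm_nonneg _)
          (Finset.prod_le_one (fun _ _ ↦ norm_nonneg _) fun _ _ ↦ ?_))
      exact ContinuousLinearMap.norm_snd_le ℝ E F
    have hp : ‖p‖ ^ k ≤ ‖p.1‖ ^ k + ‖p.2‖ ^ k := by
      rcases max_choice ‖p.1‖ ‖p.2‖ with h | h <;> rw [Prod.norm_def, h]
      · exact le_add_of_nonneg_right (by positivity)
      · exact le_add_of_nonneg_left (by positivity)
    refine (mul_le_mul_of_nonneg_left (norm_iteratedFDeriv_mul_le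
      ((f.smooth ⊤).comp contDiff_fst) ((g.smooth ⊤).comp contDiff_snd) p
      (n := n) (mod_cast le_top)) (by positivity)).trans ?_
    rw [Finset.mul_sum]
    refine Finset.sum_le_sum fun i _ ↦ ?_
    have f0 := f.norm_iteratedFDeriv_le_seminorm ℝ i p.1
    have g0 := g.norm_iteratedFDeriv_le_seminorm ℝ (n - i) p.2
    have fk := f.le_seminorm ℝ k i p.1
    have gk := g.le_seminorm ℝ k (n - i) p.2
    calc ‖p‖ ^ k * ((n.choose i : ℝ) * ‖iteratedFDeriv ℝ i (fun p : E × F ↦ f p.1) p‖ *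
          ‖iteratedFDeriv ℝ (n - i) (fun p : E × F ↦ g p.2) p‖)
        ≤ (‖p.1‖ ^ k + ‖p.2‖ ^ k) * ((n.choose i : ℝ) * ‖iteratedFDeriv ℝ i f p.1‖ *
          ‖iteratedFDeriv ℝ (n - i) g p.2‖) := by
          gcongr
          · exact hf i
          · exact hg (n - i)
      _ = (n.choose i : ℝ) *
          (‖p.1‖ ^ k * ‖iteratedFDeriv ℝ i f p.1‖ * ‖iteratedFDeriv ℝ (n - i) g p.2‖ +
            ‖iteratedFDeriv ℝ i f p.1‖ * (‖p.2‖ ^ k * ‖iteratedFDeriv ℝ (n - i) g p.2‖)) := by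
          ring
      _ ≤ _ := by gcongr

/-- A product `f (a + L y) * g (b + M y)` of Schwartz functions along affine maps whose linear
parts are jointly injective is a Schwartz function of `y`. -/
theorem SchwartzMap.exists_eq_comp_mul_comp {D E F : Type*}
    [NormedAddCommGroup D] [NormedSpace ℝ D] [FiniteDimensional ℝ D]
    [NormedAddCommGroup E] [NormedSpace ℝ E] [NormedAddCommGroup F] [NormedSpace ℝ F]
    (f : SchwartzMap E ℂ) (g : SchwartzMap F ℂ) (a : E) (b : F) (L : D →L[ℝ] E) (M : D →L[ℝ] F)
    (hLM : Function.Injective (L.prod M)) :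
    ∃ h : SchwartzMap D ℂ, ∀ y, h y = f (a + L y) * g (b + M y) := by
  obtain ⟨K, -, hK⟩ := (L.prod M).toLinearMap.exists_antilipschitzWith
    (LinearMap.ker_eq_bot.mpr hLM)
  have hT : Function.HasTemperateGrowth (fun y ↦ (a, b) + L.prod M y) :=
    (Function.HasTemperateGrowth.const (a, b)).add (L.prod M).hasTemperateGrowth
  have hA : AntilipschitzWith K (fun y ↦ (a, b) + L.prod M y) := fun x y ↦ by
    rw [edist_add_left]
    exact hK x y
  exact ⟨SchwartzMap.compCLMOfAntilipschitz ℝ hT hA (f.tensorMul g), fun _ ↦ rfl⟩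

/-- Fourier inversion for Schwartz functions on `Fin d → ℝ`, with the dot product as pairing. -/
theorem SchwartzMap.integral_cexp_mul_integral_cexp_mul_eq {d : ℕ}
    (h : SchwartzMap (Fin d → ℝ) ℂ) (z : Fin d → ℝ) :
    ∫ ω : Fin d → ℝ, Complex.exp (2 * (π : ℂ) * Complex.I * ((z ⬝ᵥ ω : ℝ) : ℂ)) *
      ∫ y : Fin d → ℝ, Complex.exp (-2 * (π : ℂ) * Complex.I * ((ω ⬝ᵥ y : ℝ) : ℂ)) * h y = h z := by
  let e : EuclideanSpace ℝ (Fin d) ≃L[ℝ] (Fin d → ℝ) := EuclideanSpace.equiv (Fin d) ℝ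
  let g : SchwartzMap (EuclideanSpace ℝ (Fin d)) ℂ :=
    SchwartzMap.compCLMOfContinuousLinearEquiv ℝ e h
  have integral_eq (F : (Fin d → ℝ) → ℂ) :
      ∫ y, F y = ∫ y : EuclideanSpace ℝ (Fin d), F (WithLp.ofLp y) :=
    ((PiLp.volume_preserving_ofLp (Fin d)).integral_comp
      (MeasurableEquiv.toLp 2 (Fin d → ℝ)).symm.measurableEmbedding F).symm
  have key : FourierTransformInv.fourierInv (FourierTransform.fourier (g : _ → ℂ))
      (WithLp.toLp 2 z) = g (WithLp.toLp 2 z) := by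
    rw [← SchwartzMap.fourier_coe, ← SchwartzMap.fourierInv_coe,
      FourierTransform.fourierInv_fourier_eq]
  change _ = g (WithLp.toLp 2 z)
  rw [← key, Real.fourierInv_eq', integral_eq]
  congr 1 with ω
  rw [Real.fourier_eq', integral_eq, smul_eq_mul]
  congr 1
  · congr 1
    simp [EuclideanSpace.inner_eq_star_dotProduct]
    ring
  · congr 1 with y
    rw [smul_eq_mul]
    congr 2
    simp [EuclideanSpace.inner_eq_star_dotProduct]
    ring

/-- Pointwise inversion formula: a Schwartz signal `f` with `f(0) ≠ 0` can be recovered from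
its matrix-Wigner distribution `B_A(f,f)`. -/
theorem mwd_pointwise_inversion {d : ℕ} (A₁₁ A₁₂ A₂₁ A₂₂ : Matrix (Fin d) (Fin d) ℝ)
    (hA : (Matrix.fromBlocks A₁₁ A₁₂ A₂₁ A₂₂).det ≠ 0)
    (f : SchwartzMap ((Fin d) → ℝ) ℂ) (hf0 : f 0 ≠ 0) (x : Fin d → ℝ) :
    f x = (conj (f 0))⁻¹ *
      ∫ ω : Fin d → ℝ,
        Complex.exp (2 * (Real.pi : ℂ) * Complex.I *
          (((((Matrix.fromBlocks A₁₁ A₁₂ A₂₁ A₂₂)⁻¹).toBlocks₂₁.mulVec x) ⬝ᵥ ω : ℝ) : ℂ)) *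
          mwd A₁₁ A₁₂ A₂₁ A₂₂ (⇑f) (⇑f)
            (((Matrix.fromBlocks A₁₁ A₁₂ A₂₁ A₂₂)⁻¹).toBlocks₁₁.mulVec x) ω := by
  set A := Matrix.fromBlocks A₁₁ A₁₂ A₂₁ A₂₂ with hA_def
  have hU : IsUnit A.det := isUnit_iff_ne_zero.mpr hA
  have hinv : A.mulVec (Sum.elim (A⁻¹.toBlocks₁₁.mulVec x) (A⁻¹.toBlocks₂₁.mulVec x)) =
      Sum.elim x 0 := by
    have h : Sum.elim (A⁻¹.toBlocks₁₁.mulVec x) (A⁻¹.toBlocks₂₁.mulVec x) =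
        A⁻¹.mulVec (Sum.elim x 0) := by
      conv_rhs => rw [← Matrix.fromBlocks_toBlocks A⁻¹, Matrix.fromBlocks_mulVec]
      simp
    rw [h, Matrix.mulVec_mulVec, Matrix.mul_nonsing_inv A hU, Matrix.one_mulVec]
  rw [hA_def, Matrix.fromBlocks_mulVec, ← hA_def, Sum.elim_eq_iff] at hinv
  obtain ⟨h₁, h₂⟩ := hinv
  simp only [Sum.elim_comp_inl, Sum.elim_comp_inr] at h₁ h₂
  have hinj : Function.Injective ((A₁₂.mulVecLin.toContinuousLinearMap).prod
      A₂₂.mulVecLin.toContinuousLinearMap) := fun y y' hy ↦ by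
    simp only [ContinuousLinearMap.prod_apply, LinearMap.coe_toContinuousLinearMap',
      Matrix.mulVecLin_apply, Prod.mk.injEq] at hy
    have h : A.mulVec (Sum.elim 0 y) = A.mulVec (Sum.elim 0 y') := by
      simp [hA_def, Matrix.fromBlocks_mulVec, hy]
    have h' := Matrix.mulVec_injective_of_isUnit ((Matrix.isUnit_iff_isUnit_det A).mpr hU) h
    exact (Sum.elim_eq_iff.mp h').2
  obtain ⟨h, hh⟩ := SchwartzMap.exists_eq_comp_mul_comp f
    (SchwartzMap.postcompCLM (𝕜 := ℝ) Complex.conjCLE.toContinuousLinearMap f)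
    (A₁₁.mulVec (A⁻¹.toBlocks₁₁.mulVec x)) (A₂₁.mulVec (A⁻¹.toBlocks₁₁.mulVec x)) _ _ hinj
  simp only [SchwartzMap.postcompCLM_apply, LinearMap.coe_toContinuousLinearMap',
    Matrix.mulVecLin_apply, ContinuousLinearEquiv.coe_coe, Complex.conjCLE_apply] at hh
  have hz := h.integral_cexp_mul_integral_cexp_mul_eq (A⁻¹.toBlocks₂₁.mulVec x)
  rw [hh, h₁, h₂] at hz
  simp only [hh, ← mul_assoc] at hz
  simp only [mwd]
  rw [hz, mul_comm, mul_inv_cancel_right₀ ((map_ne_zero _).mpr hf0)]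
end

section
/- (Covariance formula.) Let A be a real invertible (2d)×(2d) matrix. For all Schwartz functions f, g : ℝ^d → ℂ and all a, b, α, β ∈ ℝ^d, define (r, s) = A^{-1}(a, b) and (ρ, σ) = Aᵀ(α, −β) (as vectors in ℝ^d × ℝ^d). Then for all (x,ω) ∈ ℝ^d × ℝ^d, B_A(M_α T_a f, M_β T_b g)(x,ω) = e^{2πi σ·s} · e^{2πi (x·ρ − ω·s)} · B_A(f,g)(x − r, ω − σ). -/
open MeasureTheory Matrix ComplexConjugate
open scoped Real Matrix

/-- The blocks of an invertible block matrix applied to the blocks of its inverse recover the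
original pair of vectors. -/
theorem fromBlocks_mulVec_inv_blocks {d : ℕ} (A₁₁ A₁₂ A₂₁ A₂₂ : Matrix (Fin d) (Fin d) ℝ)
    (hA : (Matrix.fromBlocks A₁₁ A₁₂ A₂₁ A₂₂).det ≠ 0) (a b r s : Fin d → ℝ)
    (hr : r = ((Matrix.fromBlocks A₁₁ A₁₂ A₂₁ A₂₂)⁻¹).toBlocks₁₁.mulVec a +
        ((Matrix.fromBlocks A₁₁ A₁₂ A₂₁ A₂₂)⁻¹).toBlocks₁₂.mulVec b)
    (hs : s = ((Matrix.fromBlocks A₁₁ A₁₂ A₂₁ A₂₂)⁻¹).toBlocks₂₁.mulVec a +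
        ((Matrix.fromBlocks A₁₁ A₁₂ A₂₁ A₂₂)⁻¹).toBlocks₂₂.mulVec b) :
    A₁₁.mulVec r + A₁₂.mulVec s = a ∧ A₂₁.mulVec r + A₂₂.mulVec s = b := by
  have hinv : Sum.elim r s = (Matrix.fromBlocks A₁₁ A₁₂ A₂₁ A₂₂)⁻¹.mulVec (Sum.elim a b) := by
    conv_rhs => rw [← Matrix.fromBlocks_toBlocks (Matrix.fromBlocks A₁₁ A₁₂ A₂₁ A₂₂)⁻¹]
    rw [Matrix.fromBlocks_mulVec, hr, hs]
    simp
  have h : (Matrix.fromBlocks A₁₁ A₁₂ A₂₁ A₂₂).mulVec (Sum.elim r s) = Sum.elim a b := by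
    rw [hinv, Matrix.mulVec_mulVec, Matrix.mul_nonsing_inv _ hA.isUnit, Matrix.one_mulVec]
  rw [Matrix.fromBlocks_mulVec] at h
  exact ⟨funext fun i => by simpa using congrFun h (Sum.inl i),
    funext fun i => by simpa using congrFun h (Sum.inr i)⟩

/-- Covariance formula for matrix-Wigner distributions with respect to time-frequency
shifts `M_α T_a f`, `M_β T_b g`, where `(r,s) = A⁻¹(a,b)` and `(ρ,σ) = Aᵀ(α,−β)`. -/
theorem mwd_covariance {d : ℕ} (A₁₁ A₁₂ A₂₁ A₂₂ : Matrix (Fin d) (Fin d) ℝ)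
    (hA : (Matrix.fromBlocks A₁₁ A₁₂ A₂₁ A₂₂).det ≠ 0)
    (f g : SchwartzMap ((Fin d) → ℝ) ℂ) (a b α β : Fin d → ℝ)
    (r s ρ σ : Fin d → ℝ)
    (hr : r = ((Matrix.fromBlocks A₁₁ A₁₂ A₂₁ A₂₂)⁻¹).toBlocks₁₁.mulVec a +
        ((Matrix.fromBlocks A₁₁ A₁₂ A₂₁ A₂₂)⁻¹).toBlocks₁₂.mulVec b)
    (hs : s = ((Matrix.fromBlocks A₁₁ A₁₂ A₂₁ A₂₂)⁻¹).toBlocks₂₁.mulVec a +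
        ((Matrix.fromBlocks A₁₁ A₁₂ A₂₁ A₂₂)⁻¹).toBlocks₂₂.mulVec b)
    (hρ : ρ = A₁₁ᵀ.mulVec α - A₂₁ᵀ.mulVec β)
    (hσ : σ = A₁₂ᵀ.mulVec α - A₂₂ᵀ.mulVec β)
    (x ω : Fin d → ℝ) :
    mwd A₁₁ A₁₂ A₂₁ A₂₂
        (fun t => Complex.exp (2 * (Real.pi : ℂ) * Complex.I * ((t ⬝ᵥ α : ℝ) : ℂ)) * f (t - a))
        (fun t => Complex.exp (2 * (Real.pi : ℂ) * Complex.I * ((t ⬝ᵥ β : ℝ) : ℂ)) * g (t - b))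
        x ω =
      Complex.exp (2 * (Real.pi : ℂ) * Complex.I * ((σ ⬝ᵥ s : ℝ) : ℂ)) *
        Complex.exp (2 * (Real.pi : ℂ) * Complex.I * ((x ⬝ᵥ ρ - ω ⬝ᵥ s : ℝ) : ℂ)) *
        mwd A₁₁ A₁₂ A₂₁ A₂₂ (⇑f) (⇑g) (x - r) (ω - σ) := by
  obtain ⟨ha, hb⟩ := fromBlocks_mulVec_inv_blocks A₁₁ A₁₂ A₂₁ A₂₂ hA a b r s hr hs
  unfold mwd
  rw [← integral_const_mul]
  refine Eq.trans ?_ (integral_sub_right_eq_self _ s)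
  refine integral_congr_ae (Filter.Eventually.of_forall fun y => ?_)
  have hfa : A₁₁.mulVec (x - r) + A₁₂.mulVec (y - s) = A₁₁.mulVec x + A₁₂.mulVec y - a := by
    rw [← ha, Matrix.mulVec_sub, Matrix.mulVec_sub]
    abel
  have hgb : A₂₁.mulVec (x - r) + A₂₂.mulVec (y - s) = A₂₁.mulVec x + A₂₂.mulVec y - b := by
    rw [← hb, Matrix.mulVec_sub, Matrix.mulVec_sub]
    abel
  have hphase : -(ω ⬝ᵥ y) + (A₁₁.mulVec x + A₁₂.mulVec y) ⬝ᵥ α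
      - (A₂₁.mulVec x + A₂₂.mulVec y) ⬝ᵥ β
      = σ ⬝ᵥ s + (x ⬝ᵥ ρ - ω ⬝ᵥ s) - (ω - σ) ⬝ᵥ (y - s) := by
    have htr (M : Matrix (Fin d) (Fin d) ℝ) (u v : Fin d → ℝ) :
        M.mulVec u ⬝ᵥ v = u ⬝ᵥ Mᵀ.mulVec v := by
      rw [Matrix.mulVec_transpose, dotProduct_comm, Matrix.dotProduct_mulVec, dotProduct_comm]
    have hσy : σ ⬝ᵥ y = y ⬝ᵥ A₁₂ᵀ.mulVec α - y ⬝ᵥ A₂₂ᵀ.mulVec β := by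
      rw [hσ, dotProduct_comm, dotProduct_sub]
    have hxρ : x ⬝ᵥ ρ = x ⬝ᵥ A₁₁ᵀ.mulVec α - x ⬝ᵥ A₂₁ᵀ.mulVec β := by
      rw [hρ, dotProduct_sub]
    simp only [add_dotProduct, htr, sub_dotProduct, dotProduct_sub, hσy, hxρ]
    ring
  have hexp : Complex.exp (-2 * (Real.pi : ℂ) * Complex.I * ((ω ⬝ᵥ y : ℝ) : ℂ)) *
        Complex.exp (2 * (Real.pi : ℂ) * Complex.I *
          (((A₁₁.mulVec x + A₁₂.mulVec y) ⬝ᵥ α : ℝ) : ℂ)) *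
        conj (Complex.exp (2 * (Real.pi : ℂ) * Complex.I *
          (((A₂₁.mulVec x + A₂₂.mulVec y) ⬝ᵥ β : ℝ) : ℂ)))
      = Complex.exp (2 * (Real.pi : ℂ) * Complex.I * ((σ ⬝ᵥ s : ℝ) : ℂ)) *
        Complex.exp (2 * (Real.pi : ℂ) * Complex.I * ((x ⬝ᵥ ρ - ω ⬝ᵥ s : ℝ) : ℂ)) *
        Complex.exp (-2 * (Real.pi : ℂ) * Complex.I * (((ω - σ) ⬝ᵥ (y - s) : ℝ) : ℂ)) := by
    rw [← Complex.exp_conj, ← Complex.exp_add, ← Complex.exp_add, ← Complex.exp_add,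
      ← Complex.exp_add]
    congr 1
    simp only [map_mul, Complex.conj_ofReal, Complex.conj_I, map_ofNat]
    have hphase' := congrArg (fun t : ℝ => (t : ℂ)) hphase
    simp only [Complex.ofReal_add, Complex.ofReal_sub, Complex.ofReal_neg] at hphase' ⊢
    linear_combination (2 * (Real.pi : ℂ) * Complex.I) * hphase'
  simp only [hfa, hgb, map_mul]
  linear_combination (f (A₁₁.mulVec x + A₁₂.mulVec y - a) *
    conj (g (A₂₁.mulVec x + A₂₂.mulVec y - b))) * hexp
end

section
/- Let M₁ and M₂ be real d×d matrices with associated Cohen-type matrices A_{M₁} and A_{M₂}. Then for all Schwartz functions f, g : ℝ^d → ℂ and all ξ, η ∈ ℝ^d, the 2d-dimensional Fourier transforms satisfy F(B_{A_{M₂}}(f,g))(ξ,η) = e^{-2πi ξ·((M₂ − M₁)η)} · F(B_{A_{M₁}}(f,g))(ξ,η). -/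
open MeasureTheory Matrix ComplexConjugate
open scoped Real Matrix

/-- The Fourier transform on `ℝ^{2d}` of a function of two `ℝ^d` variables. -/
noncomputable def ft2 {d : ℕ} (F : (Fin d → ℝ) → (Fin d → ℝ) → ℂ) (ξ η : Fin d → ℝ) : ℂ :=
  ∫ w : (Fin d → ℝ) × (Fin d → ℝ),
    Complex.exp (-2 * (Real.pi : ℂ) * Complex.I * ((w.1 ⬝ᵥ ξ + w.2 ⬝ᵥ η : ℝ) : ℂ)) * F w.1 w.2

open scoped SchwartzMap FourierTransform ContDiff RealInnerProductSpace

section Schwartz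

variable {X Y V : Type*} [NormedAddCommGroup X] [NormedSpace ℝ X]
  [NormedAddCommGroup Y] [NormedSpace ℝ Y]

theorem norm_iteratedFDeriv_comp_clm_le {F : Type*} [NormedAddCommGroup F] [NormedSpace ℝ F]
    {f : Y → F} (hf : ContDiff ℝ ∞ f) (L : X →L[ℝ] Y) (hL : ‖L‖ ≤ 1) (n : ℕ) (x : X) :
    ‖iteratedFDeriv ℝ n (fun z ↦ f (L z)) x‖ ≤ ‖iteratedFDeriv ℝ n f (L x)‖ := by
  have h := L.iteratedFDeriv_comp_right hf x (i := n) (by exact_mod_cast le_top)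
  simp only [Function.comp_def] at h
  rw [h]
  refine (ContinuousMultilinearMap.norm_compContinuousLinearMap_le _ _).trans ?_
  refine mul_le_of_le_one_right (norm_nonneg _) ?_
  exact Finset.prod_le_one (fun _ _ ↦ norm_nonneg _) fun _ _ ↦ hL

namespace SchwartzMap

/-- The tensor product `(x, y) ↦ f x * g y` of two Schwartz functions. -/
noncomputable def tensorMul_s18 (f : 𝓢(X, ℂ)) (g : 𝓢(Y, ℂ)) : 𝓢(X × Y, ℂ) where
  toFun p := f p.1 * g p.2
  smooth' := ((f.smooth ⊤).comp contDiff_fst).mul ((g.smooth ⊤).comp contDiff_snd)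
  decay' k n := by
    let S (i : ℕ) := 2 ^ k * (Finset.Iic (k, i)).sup (fun m ↦ SchwartzMap.seminorm ℝ m.1 m.2) f
    let T (i : ℕ) := 2 ^ k * (Finset.Iic (k, i)).sup (fun m ↦ SchwartzMap.seminorm ℝ m.1 m.2) g
    refine ⟨∑ i ∈ Finset.range (n + 1), (n.choose i : ℝ) * S i * T (n - i), fun p ↦ ?_⟩
    have hp : ‖p‖ ^ k ≤ (1 + ‖p.1‖) ^ k * (1 + ‖p.2‖) ^ k := by
      rw [← mul_pow]
      gcongr
      rw [Prod.norm_def]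
      have := mul_nonneg (norm_nonneg p.1) (norm_nonneg p.2)
      apply max_le <;> nlinarith [norm_nonneg p.1, norm_nonneg p.2]
    have hmul := norm_iteratedFDeriv_mul_le
      ((f.smooth ⊤).comp (contDiff_fst (E := X) (F := Y)))
      ((g.smooth ⊤).comp (contDiff_snd (E := X) (F := Y))) p (n := n)
      (by exact_mod_cast le_top)
    refine (mul_le_mul hp hmul (norm_nonneg _) (by positivity)).trans ?_
    rw [Finset.mul_sum]
    refine Finset.sum_le_sum fun i _ ↦ ?_
    have hf := norm_iteratedFDeriv_comp_clm_le (f.smooth ⊤) (ContinuousLinearMap.fst ℝ X Y)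
      (ContinuousLinearMap.norm_fst_le _ _ _) i p
    have hg := norm_iteratedFDeriv_comp_clm_le (g.smooth ⊤) (ContinuousLinearMap.snd ℝ X Y)
      (ContinuousLinearMap.norm_snd_le _ _ _) (n - i) p
    have hS : (1 + ‖p.1‖) ^ k * ‖iteratedFDeriv ℝ i (f ∘ Prod.fst) p‖ ≤ S i :=
      (mul_le_mul_of_nonneg_left hf (by positivity)).trans
        (one_add_le_sup_seminorm_apply (𝕜 := ℝ) (m := (k, i)) le_rfl le_rfl f p.1)
    have hT : (1 + ‖p.2‖) ^ k * ‖iteratedFDeriv ℝ (n - i) (g ∘ Prod.snd) p‖ ≤ T (n - i) :=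
      (mul_le_mul_of_nonneg_left hg (by positivity)).trans
        (one_add_le_sup_seminorm_apply (𝕜 := ℝ) (m := (k, n - i)) le_rfl le_rfl g p.2)
    have := mul_le_mul hS hT (by positivity) (le_trans (by positivity) hS)
    calc _ = (n.choose i : ℝ) * (((1 + ‖p.1‖) ^ k * ‖iteratedFDeriv ℝ i (f ∘ Prod.fst) p‖) *
          ((1 + ‖p.2‖) ^ k * ‖iteratedFDeriv ℝ (n - i) (g ∘ Prod.snd) p‖)) := by ring
      _ ≤ (n.choose i : ℝ) * (S i * T (n - i)) := by gcongr
      _ = _ := by ring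

@[simp]
theorem tensorMul_apply (f : 𝓢(X, ℂ)) (g : 𝓢(Y, ℂ)) (p : X × Y) :
    tensorMul_s18 f g p = f p.1 * g p.2 := rfl

/-- The slice `y ↦ Ψ (x, y)` of a Schwartz function on a product. -/
noncomputable def slice (Ψ : 𝓢(X × Y, ℂ)) (x : X) : 𝓢(Y, ℂ) :=
  compCLM ℝ (g := fun y ↦ (x, y))
    (by
      simpa [Pi.add_def] using (Function.HasTemperateGrowth.const ((x, 0) : X × Y)).add
        (ContinuousLinearMap.inr ℝ X Y).hasTemperateGrowth)
    ⟨1, 1, fun y ↦ by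
      have := norm_snd_le (x, y)
      simp only [pow_one, one_mul]
      linarith⟩ Ψ

@[simp]
theorem slice_apply (Ψ : 𝓢(X × Y, ℂ)) (x : X) (y : Y) : slice Ψ x y = Ψ (x, y) := rfl

theorem norm_iteratedFDeriv_slice_le (Ψ : 𝓢(X × Y, ℂ)) (x : X) (n : ℕ) (y : Y) :
    ‖iteratedFDeriv ℝ n (slice Ψ x) y‖ ≤ ‖iteratedFDeriv ℝ n Ψ (x, y)‖ := by
  have hsmooth : ContDiff ℝ ∞ fun z : X × Y ↦ Ψ (z + (x, 0)) :=
    (Ψ.smooth ⊤).comp (contDiff_id.add contDiff_const)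
  have h := norm_iteratedFDeriv_comp_clm_le hsmooth (ContinuousLinearMap.inr ℝ X Y)
    (ContinuousLinearMap.norm_inr_le_one _ _ _) n y
  rw [iteratedFDeriv_comp_add_right] at h
  have hslice : ⇑(slice Ψ x) = fun z ↦ Ψ (x, z) := rfl
  simpa [hslice] using h

theorem seminorm_slice_le (Ψ : 𝓢(X × Y, ℂ)) (k n N : ℕ) :
    ∃ C, 0 ≤ C ∧ ∀ x, (1 + ‖x‖) ^ N * SchwartzMap.seminorm ℂ k n (slice Ψ x) ≤ C := by
  refine ⟨2 ^ (N + k) * (Finset.Iic (N + k, n)).sup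
    (fun m ↦ SchwartzMap.seminorm ℝ m.1 m.2) Ψ, by positivity, fun x ↦ ?_⟩
  rw [← le_div_iff₀' (by positivity)]
  refine seminorm_le_bound ℂ k n _ (by positivity) fun y ↦ ?_
  rw [le_div_iff₀' (by positivity)]
  refine le_trans ?_ (one_add_le_sup_seminorm_apply (𝕜 := ℝ) (m := (N + k, n)) le_rfl le_rfl
    Ψ (x, y))
  rw [pow_add, mul_assoc]
  have hx : ‖x‖ ≤ ‖(x, y)‖ := norm_fst_le (x, y)
  have hy : ‖y‖ ≤ 1 + ‖(x, y)‖ := (norm_snd_le (x, y)).trans (by linarith)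
  gcongr
  exact norm_iteratedFDeriv_slice_le Ψ x n y

theorem seminorm_slice_decay (Ψ : 𝓢(X × Y, ℂ)) (q : Seminorm ℂ 𝓢(Y, ℂ)) (hq : Continuous q)
    (N : ℕ) : ∃ C, ∀ x, (1 + ‖x‖) ^ N * q (slice Ψ x) ≤ C := by
  obtain ⟨s, C, -, hC⟩ := Seminorm.bound_of_continuous (schwartz_withSeminorms ℂ Y ℂ) q hq
  choose B hB₀ hB using fun m : ℕ × ℕ ↦ seminorm_slice_le Ψ m.1 m.2 N
  refine ⟨C * ∑ m ∈ s, B m, fun x ↦ ?_⟩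
  have h₁ : q (slice Ψ x) ≤ C * ∑ m ∈ s, SchwartzMap.seminorm ℂ m.1 m.2 (slice Ψ x) := by
    refine (hC _).trans ?_
    have := Seminorm.finset_sup_le_sum (schwartzSeminormFamily ℂ Y ℂ) s (slice Ψ x)
    rw [_root_.smul_apply, NNReal.smul_def, smul_eq_mul]
    gcongr
    simpa [schwartzSeminormFamily] using this
  calc _ ≤ (1 + ‖x‖) ^ N * (C * ∑ m ∈ s, SchwartzMap.seminorm ℂ m.1 m.2 (slice Ψ x)) := by gcongr
    _ = C * ∑ m ∈ s, (1 + ‖x‖) ^ N * SchwartzMap.seminorm ℂ m.1 m.2 (slice Ψ x) := by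
      rw [← Finset.mul_sum]; ring
    _ ≤ _ := by gcongr with m; exact hB m x

variable [NormedAddCommGroup V] [InnerProductSpace ℝ V] [FiniteDimensional ℝ V]
  [MeasurableSpace V] [BorelSpace V] [MeasurableSpace X] [BorelSpace X]
  [FiniteDimensional ℝ X]

theorem integrable_fourier_slice (Ψ : 𝓢(X × V, ℂ)) (μ : Measure X) [μ.IsAddHaarMeasure] :
    Integrable (fun p : X × V ↦ 𝓕 (slice Ψ p.1 : V → ℂ) p.2) (μ.prod volume) := by
  have hmeas : StronglyMeasurable fun p : X × V ↦ 𝓕 (slice Ψ p.1 : V → ℂ) p.2 := by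
    simp only [Real.fourier_eq]
    have hc : Continuous fun r : (X × V) × V ↦ 𝐞 (-⟪r.2, r.1.2⟫) • slice Ψ r.1.1 r.2 := by
      simp only [slice_apply]
      fun_prop
    exact hc.stronglyMeasurable.integral_prod_right'
  rw [integrable_prod_iff hmeas.aestronglyMeasurable]
  refine ⟨Filter.Eventually.of_forall fun x ↦ (𝓕 (slice Ψ x)).integrable, ?_⟩
  let L : 𝓢(V, ℂ) →L[ℂ] Lp ℂ 1 (volume : Measure V) :=
    (toLpCLM ℂ ℂ 1 volume).comp (fourierTransformCLM ℂ)
  obtain ⟨C, hC⟩ := seminorm_slice_decay Ψ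
    ((normSeminorm ℂ (Lp ℂ 1 (volume : Measure V))).comp L.toLinearMap) L.continuous.norm
    μ.integrablePower
  refine ((Measure.integrable_pow_neg_integrablePower μ).const_mul C).mono'
    hmeas.norm.integral_prod_right'.aestronglyMeasurable (Filter.Eventually.of_forall fun x ↦ ?_)
  have hL : ‖L (slice Ψ x)‖ = ∫ v, ‖𝓕 (slice Ψ x : V → ℂ) v‖ := norm_toLp_one
  rw [Real.norm_of_nonneg (by positivity), ← hL, Real.rpow_neg (by positivity),
    Real.rpow_natCast, ← div_eq_mul_inv, le_div_iff₀' (by positivity)]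
  exact hC x

theorem integral_mul_fourier_slice (Ψ : 𝓢(X × V, ℂ)) (μ : Measure X) [μ.IsAddHaarMeasure]
    {c : X → ℂ} (hc : Continuous c) (hc₁ : ∀ x, ‖c x‖ ≤ 1) (η : V) :
    ∫ p : X × V, c p.1 * (𝐞 ⟪p.2, η⟫ • 𝓕 (slice Ψ p.1 : V → ℂ) p.2) ∂(μ.prod volume) =
      ∫ x, c x * Ψ (x, η) ∂μ := by
  have h_integrable : Integrable
      (fun p : X × V ↦ c p.1 * (𝐞 ⟪p.2, η⟫ • 𝓕 (slice Ψ p.1 : V → ℂ) p.2))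
      (μ.prod volume) := by
    have h := integrable_fourier_slice Ψ μ
    refine h.norm.mono' ?_ (Filter.Eventually.of_forall fun p ↦ ?_)
    · simp only [Circle.smul_def, smul_eq_mul]
      exact (Continuous.aestronglyMeasurable (by fun_prop)).mul
        ((Continuous.aestronglyMeasurable (by fun_prop)).mul h.1)
    · rw [norm_mul, Circle.norm_smul]
      exact mul_le_of_le_one_left (norm_nonneg _) (hc₁ _)
  rw [integral_prod _ h_integrable]
  congr 1 with x
  dsimp only
  rw [integral_const_mul, ← Real.fourierInv_eq]
  congr 1
  rw [← fourier_coe, ← fourierInv_coe, FourierTransform.fourierInv_fourier_eq, slice_apply]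

end SchwartzMap

end Schwartz

section Cohen

open SchwartzMap

variable {d : ℕ}

/-- The linear map `(x, y) ↦ (x + (M + 1/2) y, x + (M - 1/2) y)` given by a Cohen-type matrix. -/
noncomputable def cohenMap (M : Matrix (Fin d) (Fin d) ℝ) :
    (Fin d → ℝ) × EuclideanSpace ℝ (Fin d) →ₗ[ℝ] (Fin d → ℝ) × (Fin d → ℝ) where
  toFun p := (p.1 + (M + (2⁻¹ : ℝ) • 1) *ᵥ p.2.ofLp, p.1 + (M - (2⁻¹ : ℝ) • 1) *ᵥ p.2.ofLp)
  map_add' p q := by ext <;> simp [mulVec_add] <;> ring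
  map_smul' c p := by ext <;> simp [mulVec_smul]

theorem cohenMap_apply (M : Matrix (Fin d) (Fin d) ℝ)
    (p : (Fin d → ℝ) × EuclideanSpace ℝ (Fin d)) :
    cohenMap M p =
      (p.1 + (M + (2⁻¹ : ℝ) • 1) *ᵥ p.2.ofLp, p.1 + (M - (2⁻¹ : ℝ) • 1) *ᵥ p.2.ofLp) := rfl

theorem ker_cohenMap (M : Matrix (Fin d) (Fin d) ℝ) : LinearMap.ker (cohenMap M) = ⊥ := by
  rw [LinearMap.ker_eq_bot']
  rintro ⟨x, y⟩ h
  rw [cohenMap_apply, Prod.mk_eq_zero] at h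
  obtain ⟨h₁, h₂⟩ := h
  have hy : y = 0 := by
    ext i
    have h₁ := congrFun h₁ i
    have h₂ := congrFun h₂ i
    simp [add_mulVec, sub_mulVec, smul_mulVec] at h₁ h₂
    simp only [PiLp.zero_apply]
    linarith
  subst hy
  simpa using h₁

/-- There is a Schwartz function `(x, y) ↦ f (x + (M + 1/2) y) * conj (g (x + (M - 1/2) y))`. -/
theorem exists_schwartz_cohen (M : Matrix (Fin d) (Fin d) ℝ) (f g : 𝓢(Fin d → ℝ, ℂ)) :
    ∃ Ψ : 𝓢((Fin d → ℝ) × EuclideanSpace ℝ (Fin d), ℂ), ∀ x y, Ψ (x, y) =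
      f (x + (M + (2⁻¹ : ℝ) • 1) *ᵥ y.ofLp) *
        conj (g (x + (M - (2⁻¹ : ℝ) • 1) *ᵥ y.ofLp)) := by
  obtain ⟨K, -, hK⟩ := (cohenMap M).exists_antilipschitzWith (ker_cohenMap M)
  exact ⟨compCLMOfAntilipschitz ℝ (LinearMap.toContinuousLinearMap (cohenMap M)).hasTemperateGrowth
    hK (tensorMul_s18 f (postcompCLM (𝕜 := ℝ) (Complex.conjCLE : ℂ →L[ℝ] ℂ) g)), fun x y ↦ rfl⟩

theorem mwd_eq_fourier_slice {A₁₁ A₁₂ A₂₁ A₂₂ : Matrix (Fin d) (Fin d) ℝ}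
    {f g : (Fin d → ℝ) → ℂ} {Ψ : 𝓢((Fin d → ℝ) × EuclideanSpace ℝ (Fin d), ℂ)}
    (hΨ : ∀ x y, Ψ (x, y) =
      f (A₁₁ *ᵥ x + A₁₂ *ᵥ y.ofLp) * conj (g (A₂₁ *ᵥ x + A₂₂ *ᵥ y.ofLp)))
    (x : Fin d → ℝ) (w : EuclideanSpace ℝ (Fin d)) :
    mwd A₁₁ A₁₂ A₂₁ A₂₂ f g x w.ofLp = 𝓕 (slice Ψ x : EuclideanSpace ℝ (Fin d) → ℂ) w := by
  rw [mwd, Real.fourier_eq', ← (PiLp.volume_preserving_ofLp (Fin d)).integral_comp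
    (MeasurableEquiv.toLp 2 (Fin d → ℝ)).symm.measurableEmbedding]
  congr 1 with v
  rw [slice_apply, hΨ, smul_eq_mul, mul_assoc, EuclideanSpace.inner_eq_star_dotProduct]
  congr 2
  simp
  ring

theorem ft2_mwd_eq_integral {A₁₁ A₁₂ A₂₁ A₂₂ : Matrix (Fin d) (Fin d) ℝ}
    {f g : (Fin d → ℝ) → ℂ} {Ψ : 𝓢((Fin d → ℝ) × EuclideanSpace ℝ (Fin d), ℂ)}
    (hΨ : ∀ x y, Ψ (x, y) =
      f (A₁₁ *ᵥ x + A₁₂ *ᵥ y.ofLp) * conj (g (A₂₁ *ᵥ x + A₂₂ *ᵥ y.ofLp)))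
    (ξ η : Fin d → ℝ) :
    ft2 (mwd A₁₁ A₁₂ A₂₁ A₂₂ f g) ξ η =
      ∫ x : Fin d → ℝ, Complex.exp (((-2 * π * (x ⬝ᵥ ξ) : ℝ) : ℂ) * Complex.I) *
        Ψ (x, WithLp.toLp 2 (-η)) := by
  have hmp : MeasurePreserving (Prod.map id (WithLp.ofLp (p := 2) (V := Fin d → ℝ)))
      ((volume : Measure (Fin d → ℝ)).prod volume) volume :=
    (MeasurePreserving.id volume).prod (PiLp.volume_preserving_ofLp (Fin d))
  have hemb : MeasurableEmbedding
      (Prod.map (id : (Fin d → ℝ) → _) (WithLp.ofLp (p := 2) (V := Fin d → ℝ))) :=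
    MeasurableEmbedding.id.prodMap (MeasurableEquiv.toLp 2 (Fin d → ℝ)).symm.measurableEmbedding
  rw [ft2, ← hmp.integral_comp hemb, ← integral_mul_fourier_slice Ψ volume
    (by unfold dotProduct; fun_prop) (fun x ↦ (Complex.norm_exp_ofReal_mul_I _).le)]
  congr 1 with p
  simp only [Prod.map_fst, Prod.map_snd, id, mwd_eq_fourier_slice hΨ]
  rw [Circle.smul_def, Real.fourierChar_apply, smul_eq_mul, ← mul_assoc, ← Complex.exp_add,
    EuclideanSpace.inner_eq_star_dotProduct]
  congr 2
  simp [dotProduct_comm η]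
  ring

theorem ft2_mwd_cohen_eq (M : Matrix (Fin d) (Fin d) ℝ) (f g : 𝓢(Fin d → ℝ, ℂ))
    (ξ η : Fin d → ℝ) :
    ft2 (mwd 1 (M + (2⁻¹ : ℝ) • 1) 1 (M - (2⁻¹ : ℝ) • 1) f g) ξ η =
      Complex.exp (((-2 * π * (ξ ⬝ᵥ M *ᵥ η) : ℝ) : ℂ) * Complex.I) *
        ∫ x : Fin d → ℝ, Complex.exp (((-2 * π * (x ⬝ᵥ ξ) : ℝ) : ℂ) * Complex.I) *
          (f (x - (2⁻¹ : ℝ) • η) * conj (g (x + (2⁻¹ : ℝ) • η))) := by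
  obtain ⟨Ψ, hΨ⟩ := exists_schwartz_cohen M f g
  rw [ft2_mwd_eq_integral (Ψ := Ψ) (by simpa only [one_mulVec] using hΨ),
    ← integral_add_right_eq_self _ (M *ᵥ η), ← integral_const_mul]
  congr 1 with x
  rw [hΨ, ← mul_assoc (Complex.exp _) (Complex.exp _), ← Complex.exp_add]
  congr 2
  · simp [dotProduct_comm ξ]
    ring
  · congr 1
    simp [add_mulVec, smul_mulVec, mulVec_neg]
    abel
  · congr 2
    simp [sub_mulVec, smul_mulVec, mulVec_neg]

end Cohen

/-- Two Cohen-type matrix-Wigner distributions are related on the Fourier side by the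
chirp multiplier `e^{-2πi ξ·(M₂−M₁)η}`. -/
theorem ft2_mwd_cohen_relation {d : ℕ} (M₁ M₂ : Matrix (Fin d) (Fin d) ℝ)
    (f g : SchwartzMap ((Fin d) → ℝ) ℂ) (ξ η : Fin d → ℝ) :
    ft2 (mwd 1 (M₂ + (2⁻¹ : ℝ) • 1) 1 (M₂ - (2⁻¹ : ℝ) • 1) (⇑f) (⇑g)) ξ η =
      Complex.exp (-2 * (Real.pi : ℂ) * Complex.I * ((ξ ⬝ᵥ (M₂ - M₁).mulVec η : ℝ) : ℂ)) *
        ft2 (mwd 1 (M₁ + (2⁻¹ : ℝ) • 1) 1 (M₁ - (2⁻¹ : ℝ) • 1) (⇑f) (⇑g)) ξ η := by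
  rw [ft2_mwd_cohen_eq, ft2_mwd_cohen_eq, ← mul_assoc, ← Complex.exp_add]
  congr 2
  simp [sub_mulVec]
  ring
end

section
/- (Weak time-support property of τ-Wigner distributions.) Let τ ∈ [0,1], let M = (τ − 1/2)·I, and let A_M be the associated Cohen-type matrix, so that B_{A_M} is the τ-Wigner distribution. Let f : ℝ^d → ℂ be a Schwartz function. If x ∈ ℝ^d does not belong to the closed convex hull of the support of f, then B_{A_M}(f,f)(x,ω) = 0 for every ω ∈ ℝ^d; equivalently, the projection onto the x-variable of the support of B_{A_M}(f,f) is contained in the closed convex hull of supp f. -/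
open MeasureTheory Matrix ComplexConjugate
open scoped Real Matrix

/-- If `x` is outside the convex hull of the support of `f`, then `f` vanishes at one of the
endpoints of any segment that `x` divides in the ratio `τ : 1 - τ`. -/
theorem eq_zero_or_eq_zero_of_notMem_convexHull {E F : Type*} [AddCommGroup E] [Module ℝ E]
    [TopologicalSpace E] [Zero F] {f : E → F} {x : E} (hx : x ∉ convexHull ℝ (tsupport f))
    {τ : ℝ} (hτ₀ : 0 ≤ τ) (hτ₁ : τ ≤ 1) (y : E) :
    f (x + τ • y) = 0 ∨ f (x + (τ - 1) • y) = 0 := by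
  by_contra! h
  have hmem {z : E} (hz : f z ≠ 0) : z ∈ convexHull ℝ (tsupport f) :=
    subset_convexHull ℝ _ (subset_tsupport f hz)
  have hcomb := convex_convexHull ℝ (tsupport f) (hmem h.1) (hmem h.2) (sub_nonneg.2 hτ₁) hτ₀
    (sub_add_cancel 1 τ)
  rw [show (1 - τ) • (x + τ • y) + τ • (x + (τ - 1) • y) = x by module] at hcomb
  exact hx hcomb

/-- Weak time-support property of `τ`-Wigner distributions: for `τ ∈ [0,1]` and
`M = (τ − 1/2) I`, if `x` is outside the closed convex hull of the support of a Schwartz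
function `f`, then `B_{A_M}(f,f)(x,ω) = 0` for all `ω`. -/
theorem tau_wigner_weak_support {d : ℕ} (τ : ℝ) (hτ₀ : 0 ≤ τ) (hτ₁ : τ ≤ 1)
    (M : Matrix (Fin d) (Fin d) ℝ) (hM : M = (τ - 2⁻¹) • (1 : Matrix (Fin d) (Fin d) ℝ))
    (f : SchwartzMap ((Fin d) → ℝ) ℂ) (x : Fin d → ℝ)
    (hx : x ∉ closure (convexHull ℝ (tsupport (⇑f)))) :
    ∀ ω : Fin d → ℝ, mwd 1 (M + (2⁻¹ : ℝ) • 1) 1 (M - (2⁻¹ : ℝ) • 1) (⇑f) (⇑f) x ω = 0 := by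
  intro ω
  have h₁ : M + (2⁻¹ : ℝ) • 1 = τ • (1 : Matrix (Fin d) (Fin d) ℝ) := by rw [hM]; module
  have h₂ : M - (2⁻¹ : ℝ) • 1 = (τ - 1) • (1 : Matrix (Fin d) (Fin d) ℝ) := by rw [hM]; module
  rw [h₁, h₂, mwd]
  refine integral_eq_zero_of_ae (.of_forall fun y => ?_)
  simp only [one_mulVec, smul_mulVec]
  rcases eq_zero_or_eq_zero_of_notMem_convexHull (fun h => hx (subset_closure h)) hτ₀ hτ₁ y
    with h | h <;> simp [h]
end
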